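/- arXiv:1604.05093 — 3 statements merged into one kernel-verified Lean document; each statement's English description precedes it below -/
import Mathlib

section
/- Let f : (0,∞) → ℝ be an entropic function normalised such that f(1) = 0, f'(1) = 1 and f''(1) = 1. Then f(t) = t·log t for all t > 0. -/
open scoped Matrix
open Matrix
open scoped ComplexOrder

noncomputable section

/-- The trace of `f` applied (by the functional calculus) to a Hermitian matrix,
computed via the eigenvalues.  Junk value `0` on non-Hermitian matrices. -/
def trFn (f : ℝ → ℝ) {d : Type} [Fintype d] [DecidableEq d] (ρ : Matrix d d ℂ) : ℝ :=
  if hρ : ρ.IsHermitian then ∑ i, f (hρ.eigenvalues i) else 0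

/-- `f` applied to a Hermitian matrix by the functional calculus (spectral theorem).
Junk value `0` on non-Hermitian matrices. -/
def matFn (f : ℝ → ℝ) {d : Type} [Fintype d] [DecidableEq d] (ρ : Matrix d d ℂ) :
    Matrix d d ℂ :=
  if hρ : ρ.IsHermitian then
    (hρ.eigenvectorUnitary : Matrix d d ℂ) *
      Matrix.diagonal (fun i => (f (hρ.eigenvalues i) : ℂ)) *
      star (hρ.eigenvectorUnitary : Matrix d d ℂ)
  else 0

/-- The partial trace over the second factor of a bipartite system `H₁ ⊗ H₂`,
where operators on `H₁ ⊗ H₂` are modelled as matrices indexed by `Fin m × Fin n`. -/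
def partialTrace {m n : ℕ} (ρ : Matrix (Fin m × Fin n) (Fin m × Fin n) ℂ) :
    Matrix (Fin m) (Fin m) ℂ :=
  Matrix.of fun i j => ∑ k : Fin n, ρ (i, k) (j, k)

/-- A convex function `f : (0,∞) → ℝ` is entropic if on every finite-dimensional
bipartite system the map `ρ ↦ -Tr f(ρ₁) + Tr f(ρ)` is convex in positive definite `ρ`,
where `ρ₁` is the partial trace of `ρ` on the first factor. -/
def IsEntropic (f : ℝ → ℝ) : Prop :=
  ConvexOn ℝ (Set.Ioi (0 : ℝ)) f ∧
  ∀ m n : ℕ,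
    ConvexOn ℝ {ρ : Matrix (Fin m × Fin n) (Fin m × Fin n) ℂ | ρ.PosDef}
      (fun ρ => - trFn f (partialTrace ρ) + trFn f ρ)

/-- A convex function `f : (0,∞) → ℝ` is subentropic of order `k` if
`G(ρ₁,…,ρ_k) = -Tr f(ρ₁+⋯+ρ_k) + Tr f(ρ₁) + ⋯ + Tr f(ρ_k)` is convex in `k`-tuples of
positive definite operators on any finite-dimensional Hilbert space. -/
def SubentropicOfOrder (f : ℝ → ℝ) (k : ℕ) : Prop :=
  ConvexOn ℝ (Set.Ioi (0 : ℝ)) f ∧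
  ∀ n : ℕ,
    ConvexOn ℝ {ρ : Fin k → Matrix (Fin n) (Fin n) ℂ | ∀ i, (ρ i).PosDef}
      (fun ρ => - trFn f (∑ i, ρ i) + ∑ i, trFn f (ρ i))

/-- A function is subentropic if it is subentropic of all orders. -/
def Subentropic (f : ℝ → ℝ) : Prop :=
  ∀ k : ℕ, SubentropicOfOrder f k

/-- Divided difference of `g`, with `g'` on the diagonal. -/
def divDiff (g : ℝ → ℝ) (x y : ℝ) : ℝ :=
  if x = y then deriv g x else (g x - g y) / (x - y)

/-- Conjugation `h ↦ U * h * U*` as a linear operator on matrices. -/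
def conjEnd {n : ℕ} (U : Matrix (Fin n) (Fin n) ℂ) :
    Module.End ℂ (Matrix (Fin n) (Fin n) ℂ) :=
  (LinearMap.mulLeft ℂ U).comp (LinearMap.mulRight ℂ (star U))

/-- Hadamard (entrywise) multiplication by a fixed matrix `L`, as a linear operator. -/
def hadamardEnd {n : ℕ} (L : Matrix (Fin n) (Fin n) ℂ) :
    Module.End ℂ (Matrix (Fin n) (Fin n) ℂ) where
  toFun h := L ⊙ h
  map_add' h₁ h₂ := Matrix.hadamard_add L h₁ h₂
  map_smul' c h := Matrix.hadamard_smul L h c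

/-- The Fréchet differential `dg(ρ)` of the matrix function induced by `g` at the
Hermitian matrix `ρ`: in a basis diagonalising `ρ` it acts as the Hadamard product
with the Löwner matrix of divided differences of `g`.  Junk value `0` at
non-Hermitian matrices. -/
def frechetDiff (g : ℝ → ℝ) {n : ℕ} (ρ : Matrix (Fin n) (Fin n) ℂ) :
    Module.End ℂ (Matrix (Fin n) (Fin n) ℂ) :=
  if hρ : ρ.IsHermitian then
    (conjEnd (hρ.eigenvectorUnitary : Matrix (Fin n) (Fin n) ℂ)).comp
      ((hadamardEnd (Matrix.of fun i j =>
          (divDiff g (hρ.eigenvalues i) (hρ.eigenvalues j) : ℂ))).comp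
        (conjEnd (star (hρ.eigenvectorUnitary : Matrix (Fin n) (Fin n) ℂ))))
  else 0

/-- The order, with respect to the trace inner product, between operators on `B(H)`:
`T ≤ S` iff `S - T` is a positive superoperator. -/
def endLE {n : ℕ} (T S : Module.End ℂ (Matrix (Fin n) (Fin n) ℂ)) : Prop :=
  ∀ h : Matrix (Fin n) (Fin n) ℂ, 0 ≤ Matrix.trace (star h * (S h - T h))

/-- The harmonic mean `H₂(A,B) = 2 (A⁻¹ + B⁻¹)⁻¹` of two (positive definite, hence
invertible) operators on `B(H)`. -/
def harmonicMeanEnd {n : ℕ} (A B : Module.End ℂ (Matrix (Fin n) (Fin n) ℂ)) :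
    Module.End ℂ (Matrix (Fin n) (Fin n) ℂ) :=
  (2 : ℂ) • Ring.inverse (Ring.inverse A + Ring.inverse B)

/-- The amplification `id_n ⊗ Φ` of a linear map on matrices. -/
def amplify {m k : ℕ} (Φ : Matrix (Fin m) (Fin m) ℂ →ₗ[ℂ] Matrix (Fin k) (Fin k) ℂ)
    (n : ℕ) (A : Matrix (Fin n × Fin m) (Fin n × Fin m) ℂ) :
    Matrix (Fin n × Fin k) (Fin n × Fin k) ℂ :=
  Matrix.of fun p q => Φ (Matrix.of fun x y => A (p.1, x) (q.1, y)) p.2 q.2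

/-- A linear map on matrices is completely positive if all its amplifications
preserve positive semidefiniteness. -/
def IsCompletelyPositive {m k : ℕ}
    (Φ : Matrix (Fin m) (Fin m) ℂ →ₗ[ℂ] Matrix (Fin k) (Fin k) ℂ) : Prop :=
  ∀ n : ℕ, ∀ A : Matrix (Fin n × Fin m) (Fin n × Fin m) ℂ,
    A.PosSemidef → (amplify Φ n A).PosSemidef

/-- A quantum channel is a completely positive trace preserving linear map. -/
def IsQuantumChannel {m k : ℕ}
    (Φ : Matrix (Fin m) (Fin m) ℂ →ₗ[ℂ] Matrix (Fin k) (Fin k) ℂ) : Prop :=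
  IsCompletelyPositive Φ ∧ ∀ A, (Φ A).trace = A.trace

lemma trFn_of_charpoly_eq (f : ℝ → ℝ) {d : Type} [Fintype d] [DecidableEq d]
    {ρ : Matrix d d ℂ} (hρ : ρ.IsHermitian) {v : d → ℝ}
    (h : ρ.charpoly = (diagonal fun i => (v i : ℂ)).charpoly) :
    trFn f ρ = ∑ i, f (v i) := by
  have h1 := hρ.roots_charpoly_eq_eigenvalues
  have h0 := Polynomial.roots_multiset_prod_X_sub_C (Finset.univ.val.map fun i => (v i : ℂ))
  rw [Multiset.map_map] at h0
  rw [h, charpoly_diagonal] at h1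
  replace h1 := h0.symm.trans h1
  have h2 := congrArg (fun s : Multiset ℂ => (s.map fun z => f z.re).sum) h1
  simp only [Multiset.map_map, Function.comp_def] at h2
  simpa [trFn, hρ] using h2.symm

lemma trFn_diagonal (f : ℝ → ℝ) {d : Type} [Fintype d] [DecidableEq d] (v : d → ℝ) :
    trFn f (diagonal fun i => (v i : ℂ)) = ∑ i, f (v i) :=
  trFn_of_charpoly_eq f (isHermitian_diagonal_of_self_adjoint _ (by ext; simp)) rfl

lemma isHermitian_conj_diagonal {d : Type} [Fintype d] [DecidableEq d] (U : Matrix d d ℂ)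
    (v : d → ℝ) : (U * diagonal (fun i => (v i : ℂ)) * Uᴴ).IsHermitian :=
  isHermitian_mul_mul_conjTranspose U (isHermitian_diagonal_of_self_adjoint _ (by ext; simp))

lemma trFn_conj_diagonal (f : ℝ → ℝ) {d : Type} [Fintype d] [DecidableEq d]
    {U : Matrix d d ℂ} (hU : Uᴴ * U = 1) (v : d → ℝ) :
    trFn f (U * diagonal (fun i => (v i : ℂ)) * Uᴴ) = ∑ i, f (v i) :=
  trFn_of_charpoly_eq f (isHermitian_conj_diagonal U v) <| by
    rw [charpoly_mul_comm, ← Matrix.mul_assoc, hU, Matrix.one_mul]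

lemma posDef_conj_diagonal {d : Type} [Fintype d] [DecidableEq d]
    {U : Matrix d d ℂ} (hU : Uᴴ * U = 1) {v : d → ℝ} (hv : ∀ i, 0 < v i) :
    (U * diagonal (fun i => (v i : ℂ)) * Uᴴ).PosDef :=
  (posDef_diagonal_iff.2 fun i => by exact_mod_cast hv i).mul_mul_conjTranspose_same <|
    vecMul_injective_of_isUnit (IsUnit.of_mul_eq_one_right _ hU)

/-- An entropic function yields a jointly convex function of the spectrum of states with a
fixed eigenbasis. -/
lemma IsEntropic.convexOn_spectrum {f : ℝ → ℝ} (hf : IsEntropic f) {m n : ℕ}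
    {U : Matrix (Fin m × Fin n) (Fin m × Fin n) ℂ} (hU : Uᴴ * U = 1) :
    ConvexOn ℝ {v : Fin m × Fin n → ℝ | ∀ i, 0 < v i} fun v =>
      -trFn f (partialTrace (U * diagonal (fun i => (v i : ℂ)) * Uᴴ)) + ∑ i, f (v i) := by
  have hconv : Convex ℝ {v : Fin m × Fin n → ℝ | ∀ i, 0 < v i} := by
    simpa [Set.pi] using convex_pi (s := Set.univ) (𝕜 := ℝ)
      (t := fun _ : Fin m × Fin n => Set.Ioi (0 : ℝ)) fun _ _ => convex_Ioi 0
  refine ⟨hconv, fun v hv w hw a b ha hb hab => ?_⟩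
  have key := (hf.2 m n).2 (posDef_conj_diagonal hU hv) (posDef_conj_diagonal hU hw) ha hb hab
  have hlin : a • (U * diagonal (fun i => (v i : ℂ)) * Uᴴ) +
      b • (U * diagonal (fun i => (w i : ℂ)) * Uᴴ) =
      U * diagonal (fun i => ((a • v + b • w) i : ℂ)) * Uᴴ := by
    rw [← Matrix.smul_mul, ← Matrix.mul_smul, ← Matrix.smul_mul, ← Matrix.mul_smul,
      ← Matrix.add_mul, ← Matrix.mul_add]
    congr 2
    ext i j
    by_cases h : i = j <;> simp [h, diagonal]
  simp only [hlin, trFn_conj_diagonal f hU] at key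
  exact key

lemma IsEntropic.convexOn_add {f : ℝ → ℝ} (hf : IsEntropic f) :
    ConvexOn ℝ (Set.Ioi (0 : ℝ) ×ˢ Set.Ioi (0 : ℝ)) fun q =>
      f q.1 + f q.2 - f (q.1 + q.2) := by
  have h := hf.convexOn_spectrum (m := 1) (n := 2) (U := 1) (by simp)
  refine ⟨(convex_Ioi 0).prod (convex_Ioi 0), fun p hp q hq a b ha hb hab => ?_⟩
  have hmem : ∀ r ∈ Set.Ioi (0 : ℝ) ×ˢ Set.Ioi (0 : ℝ),
      (fun i : Fin 1 × Fin 2 => ![r.1, r.2] i.2) ∈ {v : Fin 1 × Fin 2 → ℝ | ∀ i, 0 < v i} := by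
    rintro r ⟨h1, h2⟩ ⟨i, j⟩
    fin_cases j
    · exact h1
    · exact h2
  have key := h.2 (hmem p hp) (hmem q hq) ha hb hab
  have htr : ∀ v : Fin 1 × Fin 2 → ℝ,
      trFn f (partialTrace ((1 : Matrix (Fin 1 × Fin 2) (Fin 1 × Fin 2) ℂ) *
        diagonal (fun i => (v i : ℂ)) * 1ᴴ)) = f (v (0, 0) + v (0, 1)) := by
    intro v
    have : partialTrace ((1 : Matrix (Fin 1 × Fin 2) (Fin 1 × Fin 2) ℂ) *
        diagonal (fun i => (v i : ℂ)) * 1ᴴ) =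
        diagonal fun _ : Fin 1 => ((v (0, 0) + v (0, 1) : ℝ) : ℂ) := by
      ext i j
      fin_cases i; fin_cases j
      simp [partialTrace]
    rw [this, trFn_diagonal]
    simp
  simp only [htr, Fintype.sum_prod_type, Fin.sum_univ_two, Finset.univ_unique, Fin.default_eq_zero,
    Finset.sum_singleton, Pi.add_apply, Pi.smul_apply, smul_eq_mul, cons_val_zero,
    cons_val_one] at key
  simp only [Prod.fst_add, Prod.snd_add, Prod.smul_fst, Prod.smul_snd, smul_eq_mul]
  linarith

/-- A rotation of `ℂ² ⊗ ℂ²` sending the basis vector `e₀ ⊗ e₀` to `c e₀ ⊗ e₀ + s e₁ ⊗ e₁`. -/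
def schmidtRotation (c s : ℝ) : Matrix (Fin 2 × Fin 2) (Fin 2 × Fin 2) ℂ :=
  Matrix.of fun i j => (![![![![c, 0], ![0, -s]], ![![0, 1], ![0, 0]]],
    ![![![0, 0], ![1, 0]], ![![s, 0], ![0, c]]]] i.1 i.2 j.1 j.2 : ℝ)

lemma schmidtRotation_conjTranspose_mul {c s : ℝ} (h : c ^ 2 + s ^ 2 = 1) :
    (schmidtRotation c s)ᴴ * schmidtRotation c s = 1 := by
  have h' : (c : ℂ) * c + s * s = 1 := by exact_mod_cast (by linarith : c * c + s * s = 1)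
  ext ⟨i, j⟩ ⟨k, l⟩
  rw [Matrix.mul_apply, Fintype.sum_prod_type]
  fin_cases i <;> fin_cases j <;> fin_cases k <;> fin_cases l <;>
    simp [schmidtRotation, Fin.sum_univ_two, mul_comm, h', add_comm ((s : ℂ) * s)]

lemma IsEntropic.convexOn_schmidt {f : ℝ → ℝ} (hf : IsEntropic f) {p : ℝ} (hp0 : 0 ≤ p)
    (hp1 : p ≤ 1) :
    ConvexOn ℝ (Set.Ioi (0 : ℝ) ×ˢ Set.Ioi (0 : ℝ)) fun q =>
      f q.1 + 3 * f q.2 - f (p * q.1 + (2 - p) * q.2) - f ((1 - p) * q.1 + (1 + p) * q.2) := by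
  obtain ⟨c, hc⟩ : ∃ c : ℝ, c ^ 2 = p := ⟨√p, Real.sq_sqrt hp0⟩
  obtain ⟨s, hs⟩ : ∃ s : ℝ, s ^ 2 = 1 - p := ⟨√(1 - p), Real.sq_sqrt (by linarith)⟩
  have hcs : c ^ 2 + s ^ 2 = 1 := by rw [hc, hs]; ring
  have h := hf.convexOn_spectrum (schmidtRotation_conjTranspose_mul hcs)
  refine ⟨(convex_Ioi 0).prod (convex_Ioi 0), fun r hr q hq a b ha hb hab => ?_⟩
  let V : ℝ × ℝ → Fin 2 × Fin 2 → ℝ := fun r i => if i = (0, 0) then r.1 else r.2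
  have hmem : ∀ r ∈ Set.Ioi (0 : ℝ) ×ˢ Set.Ioi (0 : ℝ),
      V r ∈ {v : Fin 2 × Fin 2 → ℝ | ∀ i, 0 < v i} := by
    rintro r ⟨h1, h2⟩ i
    simp only [V]
    split_ifs
    · exact h1
    · exact h2
  have hV : a • V r + b • V q = V (a • r + b • q) := by
    ext i
    simp only [V, Pi.add_apply, Pi.smul_apply, Prod.fst_add, Prod.snd_add, Prod.smul_fst,
      Prod.smul_snd]
    split_ifs <;> rfl
  have key := h.2 (hmem r hr) (hmem q hq) ha hb hab
  have htr : ∀ r : ℝ × ℝ,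
      trFn f (partialTrace (schmidtRotation c s * diagonal (fun i => (V r i : ℂ)) *
        (schmidtRotation c s)ᴴ)) =
      f (p * r.1 + (2 - p) * r.2) + f ((1 - p) * r.1 + (1 + p) * r.2) := by
    intro r
    have : partialTrace (schmidtRotation c s * diagonal (fun i => (V r i : ℂ)) *
        (schmidtRotation c s)ᴴ) = diagonal fun i : Fin 2 =>
        ((![p * r.1 + (2 - p) * r.2, (1 - p) * r.1 + (1 + p) * r.2] i : ℝ) : ℂ) := by
      have hc' : (c : ℂ) ^ 2 = p := by exact_mod_cast hc
      have hs' : (s : ℂ) ^ 2 = 1 - p := by exact_mod_cast hs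
      ext i j
      fin_cases i <;> fin_cases j <;>
        simp [partialTrace, schmidtRotation, Matrix.mul_apply,
          Fintype.sum_prod_type, Fin.sum_univ_two, V]
      · linear_combination (r.1 : ℂ) * hc' + (r.2 : ℂ) * hs'
      · linear_combination (r.1 : ℂ) * hs' + (r.2 : ℂ) * hc'
    rw [this, trFn_diagonal, Fin.sum_univ_two]
    rfl
  have hsum : ∀ r : ℝ × ℝ, ∑ i, f (V r i) = f r.1 + 3 * f r.2 := by
    intro r
    simp [V, Fintype.sum_prod_type, Fin.sum_univ_two]
    ring
  simp only [hV, htr, hsum, smul_eq_mul] at key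
  simp only [smul_eq_mul]
  linarith

/-- The second right derivative at `0` of a convex function of the form
`t ↦ ∑ i, a i * f (b i + t * c i)` is nonnegative. -/
lemma sum_mul_sq_mul_nonneg_of_convexOn {ι : Type} [Fintype ι] {f h k : ℝ → ℝ}
    (hf : ∀ x > 0, HasDerivAt f (h x) x)
    (hh : ∀ x > 0, HasDerivWithinAt h (k x) (Set.Ici x) x)
    {a b c : ι → ℝ} (hb : ∀ i, 0 < b i) (hc : ∀ i, 0 ≤ c i)
    (hconv : ConvexOn ℝ (Set.Ici 0) fun t => ∑ i, a i * f (b i + t * c i)) :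
    0 ≤ ∑ i, a i * c i ^ 2 * k (b i) := by
  have hpos : ∀ i, ∀ t : ℝ, 0 ≤ t → 0 < b i + t * c i := fun i t ht =>
    add_pos_of_pos_of_nonneg (hb i) (mul_nonneg ht (hc i))
  have hlin : ∀ i, ∀ t : ℝ, HasDerivAt (fun t => b i + t * c i) (c i) t := fun i t => by
    simpa using ((hasDerivAt_id t).mul_const (c i)).const_add (b i)
  have h1 : ∀ t : ℝ, 0 ≤ t → HasDerivAt (fun t => ∑ i, a i * f (b i + t * c i))
      (∑ i, a i * (h (b i + t * c i) * c i)) t := fun t ht =>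
    HasDerivAt.fun_sum fun i _ => ((hf _ (hpos i t ht)).comp t (hlin i t)).const_mul (a i)
  have hmono : MonotoneOn (fun t => ∑ i, a i * (h (b i + t * c i) * c i)) (Set.Ici 0) := by
    intro s hs t ht hst
    rcases hst.eq_or_lt with rfl | hst
    · exact le_rfl
    · exact (hconv.le_slope_of_hasDerivAt hs ht hst (h1 s hs)).trans
        (hconv.slope_le_of_hasDerivAt hs ht hst (h1 t ht))
  have h2 : HasDerivWithinAt (fun t => ∑ i, a i * (h (b i + t * c i) * c i))
      (∑ i, a i * (k (b i) * c i * c i)) (Set.Ici 0) 0 := by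
    refine HasDerivWithinAt.fun_sum fun i _ => HasDerivWithinAt.const_mul (a i) ?_
    have h3 : HasDerivWithinAt h (k (b i)) (Set.Ici (b i)) (b i + 0 * c i) := by
      simpa using hh (b i) (hb i)
    refine (h3.comp (0 : ℝ) (hlin i 0).hasDerivWithinAt ?_).mul_const (c i)
    intro t ht
    simpa using mul_nonneg ht (hc i)
  have h4 := h2.derivWithin (uniqueDiffWithinAt_Ici 0)
  have h5 := hmono.derivWithin_nonneg (x := 0)
  rw [h4] at h5
  refine h5.trans_eq (Finset.sum_congr rfl fun i _ => by ring)

/-- A positive monotone function which is superadditive, and subadditive up to monotonicity,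
is linear. -/
lemma eq_mul_of_superadditive {g : ℝ → ℝ} (hpos : ∀ x > 0, 0 < g x)
    (hsup : ∀ x > 0, ∀ y > 0, g x + g y ≤ g (x + y))
    (hsub : ∀ x > 0, ∀ y > 0, ∀ z > 0, z < x + y → g z ≤ g x + g y) {x : ℝ} (hx : 0 < x) :
    g x = x * g 1 := by
  have h1 : ∀ n : ℕ, ∀ x : ℝ, 0 < x → (n + 1) * g x ≤ g ((n + 1) * x) := by
    intro n x hx
    induction n with
    | zero => simp
    | succ n ih =>
      have := hsup ((n + 1) * x) (by positivity) x hx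
      push_cast
      rw [show ((n : ℝ) + 1 + 1) * x = (n + 1) * x + x by ring]
      linarith
  have h2 : ∀ n : ℕ, ∀ x : ℝ, 0 < x → ∀ z : ℝ, 0 < z → z < (n + 1) * x → g z ≤ (n + 1) * g x := by
    intro n x hx
    induction n with
    | zero =>
      intro z hz hzx
      have h3 := hsup z hz (x - z) (by simp at hzx; linarith)
      have h4 := hpos (x - z) (by simp at hzx; linarith)
      simp only [CharP.cast_eq_zero, zero_add, one_mul, add_sub_cancel] at h3 ⊢
      linarith
    | succ n ih =>
      intro z hz hzx
      push_cast at hzx ⊢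
      obtain ⟨w, hw1, hw2⟩ := exists_between
        (show max 0 (z - x) < (n + 1) * x from max_lt (by positivity) (by linarith))
      have hw0 := (le_max_left _ _).trans_lt hw1
      have hw3 := (le_max_right _ _).trans_lt hw1
      have := hsub w hw0 x hx z hz (by linarith)
      linarith [ih w hw0 hw2]
  have h3 : ∀ x > 0, ∀ y > 0, g x * y ≤ x * g y := by
    intro x hx y hy
    by_contra! hlt
    have hgx := hpos x hx
    obtain ⟨q, hq1, hq2⟩ := exists_rat_btwn
      (show x / y < g x / g y from (div_lt_div_iff₀ hy (hpos y hy)).2 hlt)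
    have hq0 : (0 : ℝ) < q := (div_pos hx hy).trans hq1
    have hqpos : 0 < q := by exact_mod_cast hq0
    obtain ⟨n, hn⟩ : ∃ n : ℕ, q.num = n + 1 :=
      ⟨(q.num - 1).toNat, by have := Rat.num_pos.2 hqpos; omega⟩
    obtain ⟨m, hm⟩ : ∃ m : ℕ, q.den = m + 1 := ⟨q.den - 1, by have := q.den_pos; omega⟩
    have hqe : (q : ℝ) = (n + 1) / (m + 1) := by
      rw [Rat.cast_def, hn, hm]
      push_cast
      rfl
    have hm0 : (0 : ℝ) < m + 1 := by positivity
    rw [hqe, div_lt_div_iff₀ hy hm0] at hq1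
    rw [hqe, div_lt_div_iff₀ hm0 (hpos y hy)] at hq2
    have := h1 m x hx
    have := h2 n y hy ((m + 1) * x) (by positivity) (by linarith)
    linarith
  have h4 := h3 x hx 1 one_pos
  have h5 := h3 1 one_pos x hx
  linarith

lemma ConvexOn.comp_line {E : Type} [AddCommGroup E] [Module ℝ E] {S : Set E} {G : E → ℝ}
    (hG : ConvexOn ℝ S G) {T : Set ℝ} (hT : Convex ℝ T) (x w : E)
    (hmem : ∀ t ∈ T, x + t • w ∈ S) : ConvexOn ℝ T fun t => G (x + t • w) := by
  refine ⟨hT, fun s hs t ht a b ha hb hab => ?_⟩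
  convert hG.2 (hmem s hs) (hmem t ht) ha hb hab using 2
  rw [smul_add, smul_add, smul_smul, smul_smul, add_add_add_comm, ← add_smul, hab, one_smul,
    ← add_smul]
  rfl

lemma ConvexOn.differentiableAt_of_rightDeriv_le_leftDeriv {f : ℝ → ℝ} {S : Set ℝ} {z : ℝ}
    (hf : ConvexOn ℝ S f) (hz : z ∈ interior S)
    (h : derivWithin f (Set.Ioi z) z ≤ derivWithin f (Set.Iio z) z) : DifferentiableAt ℝ f z := by
  have h1 := hf.hasDerivWithinAt_rightDeriv_of_mem_interior hz
  have h2 := hf.hasDerivWithinAt_leftDeriv_of_mem_interior hz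
  rw [(hf.leftDeriv_le_rightDeriv_of_mem_interior hz).antisymm h] at h2
  rw [hasDerivWithinAt_Ioi_iff_Ici] at h1
  rw [hasDerivWithinAt_Iio_iff_Iic] at h2
  have h3 := h2.union h1
  rw [Set.Iic_union_Ici, hasDerivWithinAt_univ] at h3
  exact h3.differentiableAt

/-- Kinks of an entropic function anywhere would propagate to the point `1`. -/
lemma IsEntropic.differentiableAt {f : ℝ → ℝ} (hf : IsEntropic f) (h1 : DifferentiableAt ℝ f 1)
    {z : ℝ} (hz : 0 < z) : DifferentiableAt ℝ f z := by
  obtain ⟨p, hp0, hp⟩ := exists_between (show 0 < min 1 z from lt_min one_pos hz)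
  obtain ⟨hp1, hpz⟩ := lt_min_iff.1 hp
  set y := (z - p) / (2 - p) with hy
  have hy0 : 0 < y := div_pos (by linarith) (by linarith)
  have hzy : p + (2 - p) * y = z := by
    rw [hy, mul_div_cancel₀ _ (by linarith : (2 - p) ≠ 0)]
    ring
  set w := (1 - p) + (1 + p) * y with hw
  have hw0 : 0 < w := add_pos (by linarith) (mul_pos (by linarith) hy0)
  have hconv : ConvexOn ℝ (Set.Ioi 0) fun x : ℝ =>
      f x + 3 * f y - f (p * x + (2 - p) * y) - f ((1 - p) * x + (1 + p) * y) := by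
    have := (hf.convexOn_schmidt hp0.le hp1.le).comp_line (T := Set.Ioi 0) (convex_Ioi 0)
      (0, y) (1, 0) fun t ht => by simpa using ⟨ht, hy0⟩
    simpa using this
  have hint : ∀ {x : ℝ}, 0 < x → x ∈ interior (Set.Ioi (0 : ℝ)) := fun hx => by
    rwa [interior_Ioi]
  have hlin : ∀ a b : ℝ, HasDerivAt (fun x => a * x + b) a 1 := fun a b => by
    simpa using ((hasDerivAt_id (1 : ℝ)).const_mul a).add_const b
  have hcompR : ∀ a b v : ℝ, 0 < a → 0 < v → a + b = v →
      HasDerivWithinAt (fun x => f (a * x + b)) (derivWithin f (Set.Ioi v) v * a)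
        (Set.Ioi 1) 1 := fun a b v ha hv hab => by
    have h := hf.1.hasDerivWithinAt_rightDeriv_of_mem_interior (hint hv)
    rw [← hab] at h ⊢
    refine HasDerivWithinAt.comp (1 : ℝ) (s' := Set.Ioi (a + b)) (by simpa using h)
      (hlin a b).hasDerivWithinAt fun x hx => ?_
    simpa [ha] using hx
  have hcompL : ∀ a b v : ℝ, 0 < a → 0 < v → a + b = v →
      HasDerivWithinAt (fun x => f (a * x + b)) (derivWithin f (Set.Iio v) v * a)
        (Set.Iio 1) 1 := fun a b v ha hv hab => by
    have h := hf.1.hasDerivWithinAt_leftDeriv_of_mem_interior (hint hv)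
    rw [← hab] at h ⊢
    refine HasDerivWithinAt.comp (1 : ℝ) (s' := Set.Iio (a + b)) (by simpa using h)
      (hlin a b).hasDerivWithinAt fun x hx => ?_
    simpa [ha] using hx
  have hR := (((h1.hasDerivAt.hasDerivWithinAt (s := Set.Ioi 1)).add_const (3 * f y)).fun_sub
    (hcompR p _ z hp0 hz hzy)).fun_sub (hcompR (1 - p) _ w (by linarith) hw0 rfl)
  have hL := (((h1.hasDerivAt.hasDerivWithinAt (s := Set.Iio 1)).add_const (3 * f y)).fun_sub
    (hcompL p _ z hp0 hz hzy)).fun_sub (hcompL (1 - p) _ w (by linarith) hw0 rfl)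
  have hle := hconv.leftDeriv_le_rightDeriv_of_mem_interior (hint one_pos)
  rw [hR.derivWithin (uniqueDiffWithinAt_Ioi 1), hL.derivWithin (uniqueDiffWithinAt_Iio 1)] at hle
  refine hf.1.differentiableAt_of_rightDeriv_le_leftDeriv (hint hz) ?_
  have hlew := mul_le_mul_of_nonneg_right
    (hf.1.leftDeriv_le_rightDeriv_of_mem_interior (hint hw0)) (by linarith : 0 ≤ 1 - p)
  exact le_of_mul_le_mul_right (by linarith) hp0

lemma IsEntropic.concaveOn_deriv {f : ℝ → ℝ} (hf : IsEntropic f)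
    (hd : ∀ x > 0, DifferentiableAt ℝ f x) : ConcaveOn ℝ (Set.Ioi 0) (deriv f) := by
  refine ⟨convex_Ioi 0, fun x hx y hy a b ha hb hab => ?_⟩
  have hlim : ∀ x > 0, Filter.Tendsto (fun t => t⁻¹ • (f (x + t) - f x))
      (nhdsWithin 0 (Set.Ioi 0)) (nhds (deriv f x)) := fun x hx =>
    (hd x hx).hasDerivAt.tendsto_slope_zero_right
  refine le_of_tendsto_of_tendsto (((hlim x hx).const_smul a).add ((hlim y hy).const_smul b))
    (hlim _ ((convex_Ioi (0 : ℝ)) hx hy ha hb hab)) ?_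
  filter_upwards [self_mem_nhdsWithin] with t ht
  have h := (hf.convexOn_add.comp_line (T := Set.Ioi 0) (convex_Ioi 0)
    (0, t) (1, 0) fun s hs => by simpa using ⟨hs, ht⟩).2 hx hy ha hb hab
  simp only [Prod.smul_mk, Prod.mk_add_mk, smul_eq_mul, mul_one, mul_zero, zero_add, add_zero] at h
  simp only [smul_eq_mul]
  have ht' : 0 ≤ t⁻¹ := (inv_pos.2 ht).le
  have hft : a * f t + b * f t = f t := by rw [← add_mul, hab, one_mul]
  calc a * (t⁻¹ * (f (x + t) - f x)) + b * (t⁻¹ * (f (y + t) - f y))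
      = t⁻¹ * (a * (f (x + t) - f x) + b * (f (y + t) - f y)) := by ring
    _ ≤ _ := mul_le_mul_of_nonneg_left (by linarith) ht'

/-- The second derivative of an entropic function, taken from the right and equal to `1` at `1`,
is `1 / t`. -/
lemma IsEntropic.rightDeriv_deriv_eq {f k : ℝ → ℝ} (hf : IsEntropic f)
    (hd : ∀ x > 0, DifferentiableAt ℝ f x)
    (hk : ∀ x > 0, HasDerivWithinAt (deriv f) (k x) (Set.Ici x) x)
    (hanti : AntitoneOn k (Set.Ioi 0)) (hk1 : k 1 = 1) {x : ℝ} (hx : 0 < x) : k x = x⁻¹ := by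
  have hdf : ∀ x > 0, HasDerivAt f (deriv f x) x := fun x hx => (hd x hx).hasDerivAt
  have hmem : ∀ {x y u v t : ℝ}, 0 < x → 0 < y → 0 ≤ u → 0 ≤ v → t ∈ Set.Ici (0 : ℝ) →
      ((x, y) : ℝ × ℝ) + t • (u, v) ∈ Set.Ioi (0 : ℝ) ×ˢ Set.Ioi (0 : ℝ) :=
    fun hx hy hu hv ht => ⟨add_pos_of_pos_of_nonneg hx (mul_nonneg ht hu),
      add_pos_of_pos_of_nonneg hy (mul_nonneg ht hv)⟩
  have hA : ∀ x y u v : ℝ, 0 < x → 0 < y → 0 ≤ u → 0 ≤ v →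
      (u + v) ^ 2 * k (x + y) ≤ u ^ 2 * k x + v ^ 2 * k y := by
    intro x y u v hx hy hu hv
    have h := hf.convexOn_add.comp_line (convex_Ici 0) (x, y) (u, v)
      fun t ht => hmem hx hy hu hv ht
    have h2 := sum_mul_sq_mul_nonneg_of_convexOn hdf hk (a := ![1, 1, -1]) (b := ![x, y, x + y])
      (c := ![u, v, u + v])
      (fun i => by fin_cases i <;> simp <;> positivity)
      (fun i => by fin_cases i <;> simp <;> positivity) (by
        convert h using 2 with t
        simp [Fin.sum_univ_three]
        ring_nf)
    simp [Fin.sum_univ_three] at h2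
    linarith
  have hB : ∀ p x y u v : ℝ, 0 ≤ p → p ≤ 1 → 0 < x → 0 < y → 0 ≤ u → 0 ≤ v →
      (p * u + (2 - p) * v) ^ 2 * k (p * x + (2 - p) * y) +
        ((1 - p) * u + (1 + p) * v) ^ 2 * k ((1 - p) * x + (1 + p) * y) ≤
        u ^ 2 * k x + 3 * v ^ 2 * k y := by
    intro p x y u v hp0 hp1 hx hy hu hv
    have hp2 : 0 < 2 - p := by linarith
    have hp3 : 0 ≤ 1 - p := by linarith
    have h := (hf.convexOn_schmidt hp0 hp1).comp_line (convex_Ici 0) (x, y) (u, v)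
      fun t ht => hmem hx hy hu hv ht
    have h2 := sum_mul_sq_mul_nonneg_of_convexOn hdf hk (a := ![1, 3, -1, -1])
      (b := ![x, y, p * x + (2 - p) * y, (1 - p) * x + (1 + p) * y])
      (c := ![u, v, p * u + (2 - p) * v, (1 - p) * u + (1 + p) * v])
      (fun i => by fin_cases i <;> simp <;> positivity)
      (fun i => by fin_cases i <;> simp <;> positivity) (by
        convert h using 2 with t
        simp [Fin.sum_univ_four]
        ring_nf)
    simp [Fin.sum_univ_four] at h2
    linarith
  have hk0 : ∀ x > 0, 0 ≤ k x := by
    intro x hx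
    have hmono : MonotoneOn (deriv f) (Set.Ici x) :=
      (hf.1.monotoneOn_deriv hd).mono fun y hy => hx.trans_le hy
    have h := hmono.derivWithin_nonneg (x := x)
    rwa [(hk x hx).derivWithin (uniqueDiffWithinAt_Ici x)] at h
  have hkpos : ∀ x > 0, 0 < k x := by
    intro x hx
    obtain ⟨p, hp0, hp⟩ := exists_between
      (show 0 < min 1 (1 / (2 * x)) from lt_min one_pos (by positivity))
    obtain ⟨hp1, hpx⟩ := lt_min_iff.1 hp
    rw [lt_div_iff₀ (by positivity)] at hpx
    have h := hB p x (1 / 4) 1 0 hp0.le hp1.le hx (by norm_num) zero_le_one le_rfl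
    have h1 := hk0 ((1 - p) * x + (1 + p) * (1 / 4))
      (add_pos (mul_pos (by linarith) hx) (by linarith))
    have h2 : 1 ≤ k (p * x + (2 - p) * (1 / 4)) := by
      refine hk1.ge.trans <| hanti (add_pos (mul_pos hp0 hx) (by linarith) :
        0 < p * x + (2 - p) * (1 / 4)) (one_pos : (0 : ℝ) < 1) (by linarith)
    nlinarith [mul_nonneg (sq_nonneg (1 - p)) h1, pow_pos hp0 2]
  have hlin := eq_mul_of_superadditive (g := fun x => (k x)⁻¹)
    (fun x hx => inv_pos.2 (hkpos x hx))
    (fun x hx y hy => by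
      have hkx := hkpos x hx
      have hky := hkpos y hy
      have hkxy := hkpos (x + y) (add_pos hx hy)
      have h := hA x y (k x)⁻¹ (k y)⁻¹ hx hy (by positivity) (by positivity)
      rw [show (k x)⁻¹ ^ 2 * k x + (k y)⁻¹ ^ 2 * k y = ((k x)⁻¹ + (k y)⁻¹) * 1 by field_simp,
        sq, mul_assoc] at h
      rw [← one_div (k (x + y)), le_div_iff₀ hkxy]
      exact le_of_mul_le_mul_left h (by positivity))
    (fun x hx y hy z hz hzxy => by
      set p := x / (x + y)
      have hxy : 0 < x + y := add_pos hx hy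
      have hp0 : 0 < p := by positivity
      have hp1 : p < 1 := by rw [div_lt_one hxy]; linarith
      have hpx : p * (x + y) = x := div_mul_cancel₀ _ hxy.ne'
      obtain ⟨e, he0, he⟩ := exists_between
        (show 0 < min (x - p * z) (y - (1 - p) * z) from lt_min
          (by nlinarith) (by nlinarith))
      obtain ⟨hex, hey⟩ := lt_min_iff.1 he
      have hz1 : 0 < p * z + (2 - p) * (e / 2) :=
        add_pos (mul_pos hp0 hz) (mul_pos (by linarith) (by linarith))
      have hz2 : 0 < (1 - p) * z + (1 + p) * (e / 2) :=
        add_pos (mul_pos (by linarith) hz) (mul_pos (by linarith) (by linarith))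
      have hkz := hkpos z hz
      have hke := hkpos (e / 2) (by linarith)
      have h := hB p z (e / 2) (k z)⁻¹ (k (e / 2))⁻¹ hp0.le hp1.le hz (by linarith)
        (by positivity) (by positivity)
      rw [show (k z)⁻¹ ^ 2 * k z + 3 * (k (e / 2))⁻¹ ^ 2 * k (e / 2) =
        (k z)⁻¹ + 3 * (k (e / 2))⁻¹ by field_simp] at h
      have hsq : ∀ c κ : ℝ, 0 < κ → 2 * c - κ⁻¹ ≤ c ^ 2 * κ := by
        intro c κ hκ
        have : 0 ≤ κ⁻¹ * (c * κ - 1) ^ 2 := by positivity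
        have e : κ⁻¹ * (c * κ - 1) ^ 2 = c ^ 2 * κ - 2 * c + κ⁻¹ := by field_simp; ring
        linarith
      have h1 := hsq (p * (k z)⁻¹ + (2 - p) * (k (e / 2))⁻¹) _ (hkpos _ hz1)
      have h2 := hsq ((1 - p) * (k z)⁻¹ + (1 + p) * (k (e / 2))⁻¹) _ (hkpos _ hz2)
      have h3 : (k (p * z + (2 - p) * (e / 2)))⁻¹ ≤ (k x)⁻¹ :=
        inv_anti₀ (hkpos x hx) (hanti hz1 hx (by nlinarith))
      have h4 : (k ((1 - p) * z + (1 + p) * (e / 2)))⁻¹ ≤ (k y)⁻¹ :=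
        inv_anti₀ (hkpos y hy) (hanti hz2 hy (by nlinarith))
      have h5 : 0 < (k (e / 2))⁻¹ := inv_pos.2 hke
      linarith) hx
  simp only [hk1, inv_one, mul_one] at hlin
  exact inv_eq_iff_eq_inv.1 hlin

/-- A continuous function on `(0,∞)` with vanishing right derivative is constant. -/
lemma eq_of_hasDerivWithinAt_Ici_zero {φ : ℝ → ℝ} (hc : ContinuousOn φ (Set.Ioi 0))
    (hφ : ∀ x > 0, HasDerivWithinAt φ 0 (Set.Ici x) x) {x y : ℝ} (hx : 0 < x) (hy : 0 < y) :
    φ x = φ y := by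
  wlog hxy : x ≤ y generalizing x y
  · exact (this hy hx (le_of_not_ge hxy)).symm
  exact (constant_of_has_deriv_right_zero (hc.mono fun t ht => hx.trans_le ht.1)
    (fun t ht => hφ t (hx.trans_le ht.1)) y ⟨hxy, le_rfl⟩).symm

/-- An entropic function normalised by `f(1) = 0`, `f'(1) = 1` and
`f''(1) = 1` equals `t·log t` on `(0,∞)`. -/
theorem entropy_from_first_principles (f : ℝ → ℝ) (hf : IsEntropic f)
    (hf1 : f 1 = 0) (hf'1 : deriv f 1 = 1) (hf''1 : deriv (deriv f) 1 = 1) :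
    ∀ t > (0 : ℝ), f t = t * Real.log t := by
  have hd : ∀ x > 0, DifferentiableAt ℝ f x := fun x hx =>
    hf.differentiableAt (differentiableAt_of_deriv_ne_zero (by rw [hf'1]; exact one_ne_zero)) hx
  have hconc := hf.concaveOn_deriv hd
  have hint : ∀ {x : ℝ}, 0 < x → x ∈ interior (Set.Ioi (0 : ℝ)) := fun hx => by
    rwa [interior_Ioi]
  have hk : ∀ x > 0, HasDerivWithinAt (deriv f) (-derivWithin (-deriv f) (Set.Ioi x) x)
      (Set.Ici x) x := fun x hx => by
    simpa [hasDerivWithinAt_Ioi_iff_Ici] using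
      (hconc.neg.hasDerivWithinAt_rightDeriv_of_mem_interior (hint hx)).neg
  have hanti : AntitoneOn (fun x => -derivWithin (-deriv f) (Set.Ioi x) x) (Set.Ioi 0) :=
    fun x hx y hy hxy => neg_le_neg (hconc.neg.monotoneOn_rightDeriv (hint hx) (hint hy) hxy)
  have hd1 : HasDerivAt (deriv f) 1 1 := by
    have := (differentiableAt_of_deriv_ne_zero (f := deriv f) (x := 1)
      (by rw [hf''1]; exact one_ne_zero)).hasDerivAt
    rwa [hf''1] at this
  have hk1 := (uniqueDiffWithinAt_Ici (1 : ℝ)).eq_deriv _ (hk 1 one_pos) hd1.hasDerivWithinAt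
  have hderiv : ∀ x > 0, deriv f x = Real.log x + 1 := by
    intro x hx
    have h := eq_of_hasDerivWithinAt_Ici_zero (φ := fun x => deriv f x - Real.log x)
      ((hconc.continuousOn isOpen_Ioi).sub
        (Real.continuousOn_log.mono fun x hx => (ne_of_gt hx : x ≠ 0)))
      (fun x hx => by
        have h1 := hk x hx
        rw [hf.rightDeriv_deriv_eq hd hk hanti hk1 hx] at h1
        simpa using h1.fun_sub (Real.hasDerivAt_log hx.ne').hasDerivWithinAt) hx one_pos
    simp only [hf'1, Real.log_one] at h
    linarith
  intro t ht
  have hφ : ∀ x > 0, HasDerivAt (fun x => f x - x * Real.log x) 0 x := fun x hx => by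
    have h1 := (hd x hx).hasDerivAt
    rw [hderiv x hx] at h1
    simpa using h1.fun_sub (Real.hasDerivAt_mul_log hx.ne')
  have h := eq_of_hasDerivWithinAt_Ici_zero
    (fun x hx => (hφ x hx).continuousAt.continuousWithinAt)
    (fun x hx => (hφ x hx).hasDerivWithinAt) ht one_pos
  simp only [hf1, Real.log_one] at h
  linarith

end
end

section
/- Assume f : (0,∞) → ℝ is entropic. Then for every quantum channel Φ : B(H) → B(K) between finite-dimensional Hilbert spaces (a completely positive trace-preserving linear map), the entropy gain ρ ↦ −Tr_K f(Φ(ρ)) + Tr_H f(ρ) is convex in positive definite operators ρ on H. -/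
open scoped Matrix
open Matrix
open scoped ComplexOrder

noncomputable section

/-- `trFn` depends only on the characteristic polynomial. -/
lemma trFn_eq_sum_roots (f : ℝ → ℝ) {d : Type} [Fintype d] [DecidableEq d]
    {A : Matrix d d ℂ} (hA : A.IsHermitian) :
    trFn f A = (A.charpoly.roots.map fun z => f z.re).sum := by
  rw [trFn, dif_pos hA, hA.roots_charpoly_eq_eigenvalues, Multiset.map_map]
  simp

lemma isHermitian_add_smul_one {d : Type} [DecidableEq d] {A : Matrix d d ℂ}
    (hA : A.IsHermitian) (c : ℝ) : (A + (c : ℂ) • (1 : Matrix d d ℂ)).IsHermitian := by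
  refine hA.add ?_
  simp [Matrix.IsHermitian, Matrix.conjTranspose_smul]

lemma trFn_add_smul_one (f : ℝ → ℝ) {d : Type} [Fintype d] [DecidableEq d]
    {A : Matrix d d ℂ} (hA : A.IsHermitian) (c : ℝ) :
    trFn f (A + (c : ℂ) • (1 : Matrix d d ℂ)) = trFn (fun t => f (t + c)) A := by
  have hroots : (A + (c : ℂ) • (1 : Matrix d d ℂ)).charpoly =
      ∏ i, (Polynomial.X - Polynomial.C (((hA.eigenvalues i + c : ℝ) : ℂ))) := by
    have h : A + (c : ℂ) • (1 : Matrix d d ℂ) = A - Matrix.scalar d (-c : ℂ) := by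
      rw [map_neg, sub_neg_eq_add, Matrix.scalar_apply, Matrix.smul_one_eq_diagonal]
    rw [h, Matrix.charpoly_sub_scalar, hA.charpoly_eq, Polynomial.prod_comp]
    refine Finset.prod_congr rfl fun i _ => ?_
    simp
    ring
  rw [trFn_eq_sum_roots f (isHermitian_add_smul_one hA c), hroots, Polynomial.roots_prod _ _
    (Finset.prod_ne_zero_iff.mpr fun i _ => Polynomial.X_sub_C_ne_zero _), trFn, dif_pos hA]
  simp only [Polynomial.roots_X_sub_C, Multiset.bind_singleton, Multiset.map_map,
    Function.comp_def, Complex.ofReal_re, Finset.sum_map_val]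

/-- The nonzero spectrum of `V ρ Vᴴ` is that of `ρ` when `V` is an isometry. -/
lemma trFn_isometry_conj (f : ℝ → ℝ) {d e : Type} [Fintype d] [DecidableEq d]
    [Fintype e] [DecidableEq e] {V : Matrix e d ℂ} (hV : Vᴴ * V = 1)
    {ρ : Matrix d d ℂ} (hρ : ρ.IsHermitian) :
    Fintype.card d * f 0 + trFn f (V * ρ * Vᴴ) = Fintype.card e * f 0 + trFn f ρ := by
  have h := Matrix.charpoly_mul_comm' (V * ρ) Vᴴ
  rw [← Matrix.mul_assoc, hV, Matrix.one_mul] at h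
  have h' := congrArg Polynomial.roots h
  have hX (n : ℕ) : (Polynomial.X ^ n : Polynomial ℂ) ≠ 0 := by simp
  rw [Polynomial.roots_mul (mul_ne_zero (hX _) (Matrix.charpoly_monic _).ne_zero),
    Polynomial.roots_mul (mul_ne_zero (hX _) (Matrix.charpoly_monic _).ne_zero)] at h'
  have h'' := congrArg (fun s : Multiset ℂ => (s.map fun z => f z.re).sum) h'
  rw [trFn_eq_sum_roots f (Matrix.isHermitian_mul_mul_conjTranspose V hρ), trFn_eq_sum_roots f hρ]
  simpa [Multiset.map_nsmul, Multiset.sum_nsmul] using h''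

/-- Separating the contribution of the kernel from `trFn`. -/
lemma trFn_eq_update_add_kernel (f : ℝ → ℝ) {d : Type} [Fintype d] [DecidableEq d]
    {A : Matrix d d ℂ} (hA : A.IsHermitian) :
    trFn f A = trFn (Function.update f 0 0) A + (Fintype.card d - A.rank : ℝ) * f 0 := by
  have hcard : (Fintype.card d - A.rank : ℝ) =
      ∑ i, if hA.eigenvalues i = 0 then (1 : ℝ) else 0 := by
    rw [hA.rank_eq_card_non_zero_eigs, Fintype.card_subtype, ← Finset.card_univ,
      ← Finset.card_filter_add_card_filter_not (s := Finset.univ)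
        (fun i => hA.eigenvalues i = 0)]
    simp
  rw [hcard, Finset.sum_mul]
  simp only [trFn, dif_pos hA]
  rw [← Finset.sum_add_distrib]
  refine Finset.sum_congr rfl fun i _ => ?_
  by_cases h : hA.eigenvalues i = 0 <;> simp [h]

lemma tendsto_trFn_shift {f : ℝ → ℝ} (hf : ContinuousOn f (Set.Ioi 0)) {d : Type} [Fintype d]
    [DecidableEq d] {A : Matrix d d ℂ} (hA : A.PosSemidef) (c : ℝ) :
    Filter.Tendsto (fun ε : ℝ => trFn (Function.update (fun t => f (t + ε * c)) 0 0) A)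
      (nhdsWithin 0 (Set.Ioi 0)) (nhds (trFn (Function.update f 0 0) A)) := by
  simp only [trFn, dif_pos hA.isHermitian]
  refine tendsto_finsetSum _ fun i _ => ?_
  by_cases h : hA.isHermitian.eigenvalues i = 0
  · simp [h]
  · simp only [Function.update_of_ne h]
    have hpos : 0 < hA.isHermitian.eigenvalues i :=
      lt_of_le_of_ne (hA.eigenvalues_nonneg i) (Ne.symm h)
    have hlin : Filter.Tendsto (fun ε : ℝ => hA.isHermitian.eigenvalues i + ε * c) (nhds 0)
        (nhds (hA.isHermitian.eigenvalues i)) := by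
      have : Continuous fun ε : ℝ => hA.isHermitian.eigenvalues i + ε * c := by fun_prop
      simpa using this.tendsto 0
    exact ((hf.continuousAt (Ioi_mem_nhds hpos)).tendsto.comp hlin).mono_left nhdsWithin_le_nhds

/-- Stinespring dilation of a quantum channel. -/
lemma IsQuantumChannel.exists_isometry {m k : ℕ}
    {Φ : Matrix (Fin m) (Fin m) ℂ →ₗ[ℂ] Matrix (Fin k) (Fin k) ℂ} (hΦ : IsQuantumChannel Φ) :
    ∃ (d : ℕ) (V : Matrix (Fin k × Fin d) (Fin m) ℂ), Vᴴ * V = 1 ∧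
      ∀ ρ, Φ ρ = partialTrace (V * ρ * Vᴴ) := by
  let u : Fin m × Fin m → ℂ := fun p => if p.1 = p.2 then 1 else 0
  have hC := hΦ.1 m _ (Matrix.posSemidef_vecMulVec_self_star u)
  obtain ⟨d, v, hv⟩ := Matrix.posSemidef_iff_eq_sum_vecMulVec.mp hC
  have hunit (i j : Fin m) : (Matrix.of fun x y => Matrix.vecMulVec u (star u) (i, x) (j, y)) =
      Matrix.single i j (1 : ℂ) := by
    ext x y
    simp only [u, Matrix.of_apply, Matrix.vecMulVec_apply, Pi.star_apply, Matrix.single_apply]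
    by_cases h1 : i = x <;> by_cases h2 : j = y <;> simp [h1, h2]
  have hchoi (i j : Fin m) (a b : Fin k) :
      Φ (Matrix.single i j 1) a b = ∑ l, v l (i, a) * star (v l (j, b)) := by
    have h := congrFun (congrFun hv (i, a)) (j, b)
    simp only [amplify, Matrix.of_apply, hunit] at h
    rw [h, Matrix.sum_apply]
    rfl
  refine ⟨d, Matrix.of fun p i => v p.2 (i, p.1), ?_, fun ρ => ?_⟩
  · ext j i
    have h := hΦ.2 (Matrix.single i j 1)
    simp only [Matrix.trace, Matrix.diag_apply, hchoi] at h
    rw [Matrix.mul_apply, Fintype.sum_prod_type]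
    simp only [Matrix.conjTranspose_apply, Matrix.of_apply]
    simp_rw [mul_comm (star _)]
    rw [h]
    change (Matrix.single i j (1 : ℂ)).trace = _
    by_cases hij : i = j
    · subst hij
      simp
    · simp [Matrix.trace_single_eq_of_ne, hij, Matrix.one_apply_ne' hij]
  · ext a b
    conv_lhs => rw [Matrix.matrix_eq_sum_single ρ]
    simp only [map_sum, Matrix.sum_apply]
    have hs (i j : Fin m) : Matrix.single i j (ρ i j) = ρ i j • Matrix.single i j (1 : ℂ) := by
      simp
    simp only [hs, map_smul, Matrix.smul_apply, hchoi, smul_eq_mul, partialTrace, Matrix.of_apply,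
      Matrix.mul_apply, Matrix.conjTranspose_apply, Finset.sum_mul, Finset.mul_sum]
    rw [Finset.sum_comm, Finset.sum_congr rfl fun j _ => Finset.sum_comm, Finset.sum_comm]
    exact Finset.sum_congr rfl fun l _ => Finset.sum_congr rfl fun j _ =>
      Finset.sum_congr rfl fun i _ => by ring

/-- Compressing a positive definite matrix by `K` gives a matrix of the rank of `K`. -/
lemma rank_mul_posDef_mul_conjTranspose {d e : Type} [Fintype d] [DecidableEq d] [Fintype e]
    [DecidableEq e] (K : Matrix e d ℂ) {P : Matrix d d ℂ} (hP : P.PosDef) :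
    (K * P * Kᴴ).rank = K.rank := by
  open scoped MatrixOrder in
  obtain ⟨Q, rfl⟩ := CStarAlgebra.nonneg_iff_eq_star_mul_self.mp hP.posSemidef.nonneg
  have hQ : IsUnit Q.det := by
    have h := (Matrix.isUnit_iff_isUnit_det _).mp hP.isUnit
    rw [Matrix.det_mul] at h
    exact isUnit_of_mul_isUnit_right h
  have h : K * (star Q * Q) * Kᴴ = (Q * Kᴴ)ᴴ * (Q * Kᴴ) := by
    simp [Matrix.star_eq_conjTranspose, Matrix.mul_assoc]
  rw [h, Matrix.rank_conjTranspose_mul_self, Matrix.rank_mul_eq_right_of_isUnit_det _ _ hQ,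
    Matrix.rank_conjTranspose]

lemma rank_partialTrace_conj {m k d : ℕ} (V : Matrix (Fin k × Fin d) (Fin m) ℂ)
    {ρ : Matrix (Fin m) (Fin m) ℂ} (hρ : ρ.PosDef) :
    (partialTrace (V * ρ * Vᴴ)).rank =
      (Matrix.of fun (a : Fin k) (p : Fin m × Fin d) => V (a, p.2) p.1).rank := by
  rw [← rank_mul_posDef_mul_conjTranspose _ (hρ.kronecker (Matrix.PosDef.one (n := Fin d)))]
  congr 1
  ext a b
  simp only [partialTrace, Matrix.of_apply, Matrix.mul_apply, Matrix.conjTranspose_apply,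
    Fintype.sum_prod_type, Matrix.kroneckerMap_apply, Matrix.one_apply, mul_ite, mul_one, mul_zero,
    Finset.sum_mul]
  simpa using Finset.sum_comm

lemma convex_setOf_posDef {d : Type} [Fintype d] :
    Convex ℝ {ρ : Matrix d d ℂ | ρ.PosDef} := by
  intro x hx y hy a b ha hb hab
  rcases ha.eq_or_lt with rfl | ha
  · obtain rfl : b = 1 := by linarith
    simpa using hy
  · exact (Matrix.PosDef.smul hx ha).add_posSemidef (Matrix.PosSemidef.smul hy.posSemidef hb)

lemma posSemidef_partialTrace {m n : ℕ} {ρ : Matrix (Fin m × Fin n) (Fin m × Fin n) ℂ}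
    (hρ : ρ.PosSemidef) : (partialTrace ρ).PosSemidef := by
  have h : partialTrace ρ = ∑ l, ρ.submatrix (fun i => (i, l)) (fun i => (i, l)) := by
    ext i j
    simp [partialTrace, Matrix.sum_apply]
  rw [h]
  exact Matrix.posSemidef_sum _ fun l _ => hρ.submatrix _

lemma partialTrace_add_smul_one {m n : ℕ} (A : Matrix (Fin m × Fin n) (Fin m × Fin n) ℂ)
    (c : ℝ) : partialTrace (A + (c : ℂ) • (1 : Matrix (Fin m × Fin n) (Fin m × Fin n) ℂ)) =
      partialTrace A + ((c * n : ℝ) : ℂ) • (1 : Matrix (Fin m) (Fin m) ℂ) := by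
  ext i j
  by_cases h : i = j <;>
    simp [partialTrace, Finset.sum_add_distrib, Matrix.one_apply, h, mul_comm]


/-- For an entropic function `f`, the entropy gain
`ρ ↦ -Tr_K f(Φ(ρ)) + Tr_H f(ρ)` over any quantum channel `Φ` is convex in positive
definite `ρ` (with the convention `f(0) = 0` on the output side). -/
theorem entropy_gain_convex (f : ℝ → ℝ) (hf : IsEntropic f) (m k : ℕ)
    (Φ : Matrix (Fin m) (Fin m) ℂ →ₗ[ℂ] Matrix (Fin k) (Fin k) ℂ)
    (hΦ : IsQuantumChannel Φ) :
    ConvexOn ℝ {ρ : Matrix (Fin m) (Fin m) ℂ | ρ.PosDef}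
      (fun ρ => - trFn (Function.update f 0 0) (Φ ρ) + trFn f ρ) := by
  obtain ⟨d, V, hV, hrep⟩ := hΦ.exists_isometry
  have hcont : ContinuousOn f (Set.Ioi 0) := hf.1.continuousOn isOpen_Ioi
  let r := (Matrix.of fun (a : Fin k) (p : Fin m × Fin d) => V (a, p.2) p.1).rank
  let H (ε : ℝ) (σ : Matrix (Fin m) (Fin m) ℂ) : ℝ :=
    -trFn (Function.update (fun t => f (t + ε * d)) 0 0) (Φ σ) + trFn (fun t => f (t + ε * 1)) σ
  let c (ε : ℝ) : ℝ := -((k - r : ℝ) * f (ε * d)) + ((k * d : ℕ) - m : ℝ) * f ε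
  have hpsd {σ : Matrix (Fin m) (Fin m) ℂ} (hσ : σ.PosDef) : (V * σ * Vᴴ).PosSemidef :=
    hσ.posSemidef.mul_mul_conjTranspose_same V
  have hΦpsd {σ : Matrix (Fin m) (Fin m) ℂ} (hσ : σ.PosDef) : (Φ σ).PosSemidef := by
    rw [hrep]
    exact posSemidef_partialTrace (hpsd hσ)
  let D (ε : ℝ) (σ : Matrix (Fin m) (Fin m) ℂ) :=
    V * σ * Vᴴ + (ε : ℂ) • (1 : Matrix (Fin k × Fin d) (Fin k × Fin d) ℂ)
  have hD {ε : ℝ} (hε : 0 < ε) {σ : Matrix (Fin m) (Fin m) ℂ} (hσ : σ.PosDef) :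
      (D ε σ).PosDef :=
    Matrix.PosDef.posSemidef_add (hpsd hσ) (Matrix.PosDef.one.smul (by exact_mod_cast hε))
  have hgain {ε : ℝ} {σ : Matrix (Fin m) (Fin m) ℂ} (hσ : σ.PosDef) :
      -trFn f (partialTrace (D ε σ)) + trFn f (D ε σ) = c ε + H ε σ := by
    have h1 := trFn_eq_update_add_kernel (fun t => f (t + ε * d)) (hΦpsd hσ).isHermitian
    have h2 := trFn_isometry_conj (fun t => f (t + ε)) hV hσ.isHermitian
    rw [hrep, rank_partialTrace_conj V hσ, ← hrep] at h1
    simp only [D, partialTrace_add_smul_one, ← hrep,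
      trFn_add_smul_one f (hΦpsd hσ).isHermitian, trFn_add_smul_one f (hpsd hσ).isHermitian]
    simp only [Fintype.card_fin, Fintype.card_prod, zero_add] at h1 h2
    simp only [c, H, r, h1, mul_one]
    linarith
  have hlim {σ : Matrix (Fin m) (Fin m) ℂ} (hσ : σ.PosDef) :
      Filter.Tendsto (fun ε => H ε σ) (nhdsWithin 0 (Set.Ioi 0))
        (nhds (-trFn (Function.update f 0 0) (Φ σ) + trFn f σ)) := by
    refine (tendsto_trFn_shift hcont (hΦpsd hσ) d).neg.add ?_
    have hup (g : ℝ → ℝ) : trFn (Function.update g 0 0) σ = trFn g σ := by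
      simp only [trFn, dif_pos hσ.isHermitian]
      exact Finset.sum_congr rfl fun i _ => Function.update_of_ne (hσ.eigenvalues_pos i).ne' _ _
    simpa only [hup] using tendsto_trFn_shift hcont hσ.posSemidef 1
  refine ⟨convex_setOf_posDef, fun x hx y hy a b ha hb hab => ?_⟩
  have hz := convex_setOf_posDef hx hy ha hb hab
  refine le_of_tendsto_of_tendsto (hlim hz)
    (((hlim hx).const_smul a).add ((hlim hy).const_smul b)) ?_
  filter_upwards [self_mem_nhdsWithin] with ε hε
  have h := (hf.2 k d).2 (hD hε hx) (hD hε hy) ha hb hab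
  have hcomb : a • D ε x + b • D ε y = D ε (a • x + b • y) := by
    have hone (M : Matrix (Fin k × Fin d) (Fin k × Fin d) ℂ) : M = a • M + b • M := by
      rw [← add_smul, hab, one_smul]
    simp only [D, Matrix.mul_add, Matrix.add_mul, Matrix.mul_smul, Matrix.smul_mul, smul_add]
    conv_rhs => rw [hone ((ε : ℂ) • 1)]
    abel
  simp only [hcomb] at h
  rw [hgain hz, hgain hx, hgain hy] at h
  simp only [smul_eq_mul] at h ⊢
  have hc : c ε = a * c ε + b * c ε := by rw [← add_mul, hab, one_mul]
  linarith

end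
end

section
/- A function f : (0,∞) → ℝ that is subentropic of order two is operator convex. -/
open scoped Matrix
open Matrix
open scoped ComplexOrder

noncomputable section

section FunctionalCalculus

variable {d e : Type} [Fintype d] [DecidableEq d] [Fintype e] [DecidableEq e]

lemma matFn_of_isHermitian (p : ℝ → ℝ) {A : Matrix d d ℂ} (hA : A.IsHermitian) :
    matFn p A = (hA.eigenvectorUnitary : Matrix d d ℂ) *
      Matrix.diagonal (fun i => (p (hA.eigenvalues i) : ℂ)) *
      star (hA.eigenvectorUnitary : Matrix d d ℂ) := dif_pos hA

lemma matFn_id {A : Matrix d d ℂ} (hA : A.IsHermitian) : matFn (fun x => x) A = A := by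
  rw [matFn_of_isHermitian _ hA]
  conv_rhs => rw [hA.spectral_theorem, Unitary.conjStarAlgAut_apply]
  rfl

/-- If `A S = S diag(a)`, then `p(A) S = S diag(p(a))`. -/
lemma matFn_mul_eq_mul_diagonal (p : ℝ → ℝ) {A : Matrix d d ℂ} (hA : A.IsHermitian)
    {S : Matrix d e ℂ} {a : e → ℝ}
    (h : A * S = S * Matrix.diagonal (fun j => (a j : ℂ))) :
    matFn p A * S = S * Matrix.diagonal (fun j => (p (a j) : ℂ)) := by
  set W := (hA.eigenvectorUnitary : Matrix d d ℂ) with hW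
  have h1 : star W * W = 1 := Unitary.coe_star_mul_self hA.eigenvectorUnitary
  have h2 : W * star W = 1 := Unitary.coe_mul_star_self hA.eigenvectorUnitary
  have h3 : Matrix.diagonal (fun i => (hA.eigenvalues i : ℂ)) * (star W * S)
      = (star W * S) * Matrix.diagonal (fun j => (a j : ℂ)) := by
    have := matFn_id hA
    rw [matFn_of_isHermitian _ hA, ← hW] at this
    rw [Matrix.mul_assoc, ← h]
    conv_rhs => rw [← this]
    simp only [← Matrix.mul_assoc, h1, Matrix.one_mul]
  have h4 : Matrix.diagonal (fun i => (p (hA.eigenvalues i) : ℂ)) * (star W * S)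
      = (star W * S) * Matrix.diagonal (fun j => (p (a j) : ℂ)) := by
    ext i j
    have h5 := congrFun (congrFun h3 i) j
    rw [Matrix.diagonal_mul, Matrix.mul_diagonal, mul_comm, ← sub_eq_zero, ← mul_sub,
      mul_eq_zero] at h5
    rw [Matrix.diagonal_mul, Matrix.mul_diagonal, mul_comm]
    rcases h5 with h5 | h5
    · simp [h5]
    · rw [sub_eq_zero] at h5
      rw [Complex.ofReal_inj.1 h5]
  rw [matFn_of_isHermitian _ hA, ← hW, Matrix.mul_assoc, Matrix.mul_assoc, h4,
    ← Matrix.mul_assoc, ← Matrix.mul_assoc, h2, Matrix.one_mul]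

lemma matFn_mul_eq_mul_matFn (p : ℝ → ℝ) {A : Matrix d d ℂ} (hA : A.IsHermitian)
    {B : Matrix e e ℂ} (hB : B.IsHermitian) {S : Matrix d e ℂ} (h : A * S = S * B) :
    matFn p A * S = S * matFn p B := by
  set W := (hB.eigenvectorUnitary : Matrix e e ℂ) with hW
  have h1 : star W * W = 1 := Unitary.coe_star_mul_self hB.eigenvectorUnitary
  have h2 : W * star W = 1 := Unitary.coe_mul_star_self hB.eigenvectorUnitary
  have h3 : A * (S * W) = S * W * Matrix.diagonal (fun j => (hB.eigenvalues j : ℂ)) := by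
    have := matFn_id hB
    rw [matFn_of_isHermitian _ hB, ← hW] at this
    rw [← Matrix.mul_assoc, h]
    conv_lhs => rw [← this]
    simp only [Matrix.mul_assoc, h1, Matrix.mul_one]
  have h4 := matFn_mul_eq_mul_diagonal p hA h3
  rw [matFn_of_isHermitian _ hB, ← hW, ← Matrix.mul_assoc, ← Matrix.mul_assoc, ← h4]
  simp only [Matrix.mul_assoc, h2, Matrix.mul_one]

/-- Functional calculus and composition with a function `r` mapping `A` to `B`. -/
lemma matFn_comp_of_eq (p r : ℝ → ℝ) {A B : Matrix d d ℂ} (hA : A.IsHermitian)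
    (hB : B.IsHermitian) (h : B = matFn r A) : matFn p B = matFn (fun x => p (r x)) A := by
  set W := (hA.eigenvectorUnitary : Matrix d d ℂ) with hW
  have h1 : star W * W = 1 := Unitary.coe_star_mul_self hA.eigenvectorUnitary
  have h2 : W * star W = 1 := Unitary.coe_mul_star_self hA.eigenvectorUnitary
  have h3 : B * W = W * Matrix.diagonal (fun j => (r (hA.eigenvalues j) : ℂ)) := by
    rw [h, matFn_of_isHermitian _ hA, ← hW]
    simp only [Matrix.mul_assoc, h1, Matrix.mul_one]
  have h4 := matFn_mul_eq_mul_diagonal p hB h3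
  rw [matFn_of_isHermitian _ hA, ← hW, ← h4, Matrix.mul_assoc, h2, Matrix.mul_one]

lemma isHermitian_matFn (p : ℝ → ℝ) (A : Matrix d d ℂ) : (matFn p A).IsHermitian := by
  by_cases hA : A.IsHermitian
  · rw [matFn_of_isHermitian _ hA]
    refine Matrix.isHermitian_mul_mul_conjTranspose _ ?_
    exact Matrix.isHermitian_diagonal_of_self_adjoint _ (by ext i; simp)
  · rw [matFn, dif_neg hA]
    exact Matrix.isHermitian_zero

lemma matFn_const (c : ℝ) {A : Matrix d d ℂ} (hA : A.IsHermitian) :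
    matFn (fun _ => c) A = c • (1 : Matrix d d ℂ) := by
  have h2 : (hA.eigenvectorUnitary : Matrix d d ℂ) * star (hA.eigenvectorUnitary : Matrix d d ℂ)
    = 1 := Unitary.coe_mul_star_self hA.eigenvectorUnitary
  have h3 : Matrix.diagonal (fun _ : d => (c : ℂ)) = c • (1 : Matrix d d ℂ) := by
    ext i j
    by_cases h : i = j <;> simp [h]
  rw [matFn_of_isHermitian _ hA, h3]
  simp [h2]

lemma matFn_add (p q : ℝ → ℝ) (A : Matrix d d ℂ) :
    matFn (fun x => p x + q x) A = matFn p A + matFn q A := by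
  by_cases hA : A.IsHermitian
  · simp only [matFn_of_isHermitian _ hA, ← Matrix.add_mul, ← Matrix.mul_add,
      Matrix.diagonal_add, Complex.ofReal_add]
  · simp [matFn, hA]

lemma matFn_const_mul (c : ℝ) (p : ℝ → ℝ) (A : Matrix d d ℂ) :
    matFn (fun x => c * p x) A = c • matFn p A := by
  by_cases hA : A.IsHermitian
  · have : Matrix.diagonal (fun i => ((c * p (hA.eigenvalues i) : ℝ) : ℂ))
      = c • Matrix.diagonal (fun i => (p (hA.eigenvalues i) : ℂ)) := by
      ext i j
      by_cases h : i = j <;> simp [h]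
    simp only [matFn_of_isHermitian _ hA, this, Matrix.mul_smul, Matrix.smul_mul]
  · simp [matFn, hA]

lemma matFn_mul (p q : ℝ → ℝ) (A : Matrix d d ℂ) :
    matFn (fun x => p x * q x) A = matFn p A * matFn q A := by
  by_cases hA : A.IsHermitian
  · have h1 : star (hA.eigenvectorUnitary : Matrix d d ℂ) *
      (hA.eigenvectorUnitary : Matrix d d ℂ) = 1 := Unitary.coe_star_mul_self hA.eigenvectorUnitary
    simp only [matFn_of_isHermitian _ hA]
    simp only [Matrix.mul_assoc]
    rw [← Matrix.mul_assoc (star _) _ (Matrix.diagonal _ * _), h1, Matrix.one_mul,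
      ← Matrix.mul_assoc (Matrix.diagonal _) (Matrix.diagonal _), Matrix.diagonal_mul_diagonal]
    simp only [Complex.ofReal_mul]
  · simp [matFn, hA]

lemma matFn_congr {p q : ℝ → ℝ} {A : Matrix d d ℂ} (hA : A.IsHermitian)
    (h : ∀ i, p (hA.eigenvalues i) = q (hA.eigenvalues i)) : matFn p A = matFn q A := by
  simp only [matFn_of_isHermitian _ hA, h]

lemma posSemidef_matFn_iff (p : ℝ → ℝ) {A : Matrix d d ℂ} (hA : A.IsHermitian) :
    (matFn p A).PosSemidef ↔ ∀ i, 0 ≤ p (hA.eigenvalues i) := by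
  rw [matFn_of_isHermitian _ hA, Matrix.IsUnit.posSemidef_star_right_conjugate_iff
    (Unitary.isUnit_coe (U := hA.eigenvectorUnitary)), Matrix.posSemidef_diagonal_iff]
  simp

lemma matFn_affine (a b : ℝ) {A : Matrix d d ℂ} (hA : A.IsHermitian) :
    matFn (fun x => a + b * x) A = a • (1 : Matrix d d ℂ) + b • A := by
  rw [matFn_add (fun _ => a) (fun x => b * x), matFn_const _ hA,
    matFn_const_mul b (fun x => x), matFn_id hA]

lemma posSemidef_sub_smul_one_iff (c : ℝ) {A : Matrix d d ℂ} (hA : A.IsHermitian) :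
    (A - c • (1 : Matrix d d ℂ)).PosSemidef ↔ ∀ i, c ≤ hA.eigenvalues i := by
  have : A - c • (1 : Matrix d d ℂ) = matFn (fun x => -c + 1 * x) A := by
    rw [matFn_affine _ _ hA]
    simp [sub_eq_add_neg, add_comm]
  rw [this, posSemidef_matFn_iff _ hA]
  simp

lemma trace_matFn_mul (A Z : Matrix d d ℂ) (hA : A.IsHermitian) (p : ℝ → ℝ) :
    (Matrix.trace (matFn p A * Z)).re = ∑ i, p (hA.eigenvalues i) *
      ((star (hA.eigenvectorUnitary : Matrix d d ℂ) * Z *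
        (hA.eigenvectorUnitary : Matrix d d ℂ)) i i).re := by
  rw [matFn_of_isHermitian _ hA, Matrix.mul_assoc, Matrix.mul_assoc, Matrix.trace_mul_comm,
    Matrix.mul_assoc, Matrix.trace]
  simp [Matrix.diagonal_mul, Matrix.mul_assoc]

lemma weight_nonneg {A Z : Matrix d d ℂ} (hA : A.IsHermitian) (hZ : Z.PosSemidef) (i : d) :
    0 ≤ ((star (hA.eigenvectorUnitary : Matrix d d ℂ) * Z *
        (hA.eigenvectorUnitary : Matrix d d ℂ)) i i).re :=
  (Complex.le_def.1 ((hZ.conjTranspose_mul_mul_same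
    (hA.eigenvectorUnitary : Matrix d d ℂ)).diag_nonneg (i := i))).1

lemma trace_matFn_mul_matFn {A B : Matrix d d ℂ} (hA : A.IsHermitian) (hB : B.IsHermitian)
    (p q : ℝ → ℝ) :
    (Matrix.trace (matFn p A * matFn q B)).re = ∑ i, ∑ j, p (hA.eigenvalues i) *
      q (hB.eigenvalues j) * Complex.normSq ((star (hA.eigenvectorUnitary : Matrix d d ℂ) *
        (hB.eigenvectorUnitary : Matrix d d ℂ)) i j) := by
  rw [trace_matFn_mul _ _ hA]
  refine Finset.sum_congr rfl fun i _ => ?_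
  set U := (hA.eigenvectorUnitary : Matrix d d ℂ)
  set W := (hB.eigenvectorUnitary : Matrix d d ℂ) with hW
  have : star U * matFn q B * U = (star U * W) *
      Matrix.diagonal (fun j => (q (hB.eigenvalues j) : ℂ)) * star (star U * W) := by
    rw [matFn_of_isHermitian _ hB, star_mul, star_star]
    simp only [Matrix.mul_assoc, ← hW]
  rw [this, Matrix.mul_apply, Complex.re_sum, Finset.mul_sum]
  refine Finset.sum_congr rfl fun j _ => ?_
  rw [Matrix.mul_diagonal, Matrix.star_apply, mul_assoc, mul_assoc]
  congr 1
  rw [mul_left_comm, Complex.star_def, Complex.mul_conj, ← Complex.ofReal_mul, Complex.ofReal_re]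

lemma trFn_eq_re_trace (p : ℝ → ℝ) {A : Matrix d d ℂ} (hA : A.IsHermitian) :
    trFn p A = (Matrix.trace (matFn p A)).re := by
  have h1 : star (hA.eigenvectorUnitary : Matrix d d ℂ) *
      (hA.eigenvectorUnitary : Matrix d d ℂ) = 1 := Unitary.coe_star_mul_self hA.eigenvectorUnitary
  have := trace_matFn_mul A 1 hA p
  rw [Matrix.mul_one] at this
  rw [this, trFn, dif_pos hA]
  simp [h1]

/-- Klein's inequality for a function `f` with subgradient `g` on the spectra of `A` and `B`. -/
lemma klein_inequality {f g : ℝ → ℝ} {A B : Matrix d d ℂ} (hA : A.IsHermitian)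
    (hB : B.IsHermitian) (h : ∀ i j, f (hB.eigenvalues j) +
      g (hB.eigenvalues j) * (hA.eigenvalues i - hB.eigenvalues j) ≤ f (hA.eigenvalues i)) :
    trFn f B + (Matrix.trace (matFn g B * (A - B))).re ≤ trFn f A := by
  have e1 : trFn f A = (Matrix.trace (matFn f A * matFn (fun _ => 1) B)).re := by
    rw [trFn_eq_re_trace _ hA, matFn_const _ hB, one_smul, Matrix.mul_one]
  have e2 : trFn f B = (Matrix.trace (matFn (fun _ => 1) A * matFn f B)).re := by
    rw [trFn_eq_re_trace _ hB, matFn_const _ hA, one_smul, Matrix.one_mul]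
  have e3 : (Matrix.trace (matFn g B * (A - B))).re =
      (Matrix.trace (matFn (fun x => x) A * matFn g B)).re -
        (Matrix.trace (matFn (fun _ => 1) A * matFn (fun x => g x * x) B)).re := by
    rw [matFn_id hA, matFn_const _ hA, one_smul, Matrix.one_mul, matFn_mul g (fun x => x),
      matFn_id hB, Matrix.mul_sub, Matrix.trace_sub, Matrix.trace_mul_comm, Complex.sub_re]
  rw [e1, e2, e3]
  simp only [trace_matFn_mul_matFn hA hB, ← Finset.sum_sub_distrib, ← Finset.sum_add_distrib]
  refine Finset.sum_le_sum fun i _ => Finset.sum_le_sum fun j _ => ?_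
  have := mul_le_mul_of_nonneg_right (h i j) (Complex.normSq_nonneg
    ((star (hA.eigenvectorUnitary : Matrix d d ℂ) * (hB.eigenvectorUnitary : Matrix d d ℂ)) i j))
  linarith

lemma posSemidef_of_trace_mul_nonneg {M : Matrix d d ℂ} (hM : M.IsHermitian)
    (h : ∀ Z : Matrix d d ℂ, Z.PosDef → 0 ≤ (Matrix.trace (M * Z)).re) : M.PosSemidef := by
  refine Matrix.PosSemidef.of_dotProduct_mulVec_nonneg hM fun v => ?_
  have him := hM.im_star_dotProduct_mulVec_self v
  rw [Complex.le_def]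
  refine ⟨?_, by simpa using him.symm⟩
  have key : ∀ δ : ℝ, 0 < δ → 0 ≤ (star v ⬝ᵥ M *ᵥ v).re + δ * (Matrix.trace M).re := by
    intro δ hδ
    have hZ : (Matrix.vecMulVec v (star v) + δ • (1 : Matrix d d ℂ)).PosDef :=
      Matrix.PosDef.posSemidef_add (Matrix.posSemidef_vecMulVec_self_star v)
        (Matrix.PosDef.one.smul hδ)
    have := h _ hZ
    rw [Matrix.mul_add, Matrix.trace_add, Matrix.mul_vecMulVec, Matrix.trace_vecMulVec,
      Matrix.mul_smul, Matrix.mul_one, Matrix.trace_smul, dotProduct_comm] at this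
    simpa using this
  have hlim : Filter.Tendsto (fun δ : ℝ => (star v ⬝ᵥ M *ᵥ v).re + δ * (Matrix.trace M).re)
      (nhdsWithin 0 (Set.Ioi 0)) (nhds ((star v ⬝ᵥ M *ᵥ v).re + 0 * (Matrix.trace M).re)) := by
    refine Filter.Tendsto.mono_left ?_ nhdsWithin_le_nhds
    exact Continuous.tendsto (by fun_prop) 0
  have := ge_of_tendsto hlim (eventually_mem_nhdsWithin.mono fun δ hδ => key δ hδ)
  simpa using this

lemma trace_mul_nonneg {M Z : Matrix d d ℂ} (hM : M.PosSemidef) (hZ : Z.PosSemidef) :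
    0 ≤ (Matrix.trace (M * Z)).re := by
  rw [← matFn_id hM.isHermitian, trace_matFn_mul _ _ hM.isHermitian]
  exact Finset.sum_nonneg fun i _ => mul_nonneg (hM.eigenvalues_nonneg i)
    (weight_nonneg hM.isHermitian hZ i)

end FunctionalCalculus

section Monotonicity

variable {n : ℕ} {f g : ℝ → ℝ}

lemma exists_pos_le_eigenvalues {d : Type} [Fintype d] [DecidableEq d] {A : Matrix d d ℂ}
    (hA : A.PosDef) : ∃ c : ℝ, 0 < c ∧ ∀ i, c ≤ hA.isHermitian.eigenvalues i := by
  obtain hd | hd := isEmpty_or_nonempty d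
  · exact ⟨1, one_pos, fun i => isEmptyElim i⟩
  · obtain ⟨i, hi⟩ := Finite.exists_min hA.isHermitian.eigenvalues
    exact ⟨_, hA.eigenvalues_pos i, hi⟩

lemma exists_smul_one_sub_posSemidef {d : Type} [Fintype d] [DecidableEq d] {A : Matrix d d ℂ}
    (hA : A.IsHermitian) : ∃ z : ℝ, 0 < z ∧ (z • (1 : Matrix d d ℂ) - A).PosSemidef := by
  have key : ∃ z : ℝ, 0 < z ∧ ∀ i, hA.eigenvalues i ≤ z := by
    obtain hd | hd := isEmpty_or_nonempty d
    · exact ⟨1, one_pos, fun i => isEmptyElim i⟩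
    · obtain ⟨i, hi⟩ := Finite.exists_max hA.eigenvalues
      exact ⟨max 1 (hA.eigenvalues i), by positivity, fun j => (hi j).trans (le_max_right _ _)⟩
  obtain ⟨z, hz, h⟩ := key
  refine ⟨z, hz, ?_⟩
  have : z • (1 : Matrix d d ℂ) - A = matFn (fun x => z + (-1) * x) A := by
    rw [matFn_affine _ _ hA]
    simp [sub_eq_add_neg]
  rw [this, posSemidef_matFn_iff _ hA]
  intro i
  linarith [h i]

lemma SubentropicOfOrder.trFn_increment_concave (hf : SubentropicOfOrder f 2)
    {A B S : Matrix (Fin n) (Fin n) ℂ} (hA : A.PosDef) (hB : B.PosDef) (hS : S.PosDef)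
    {a b : ℝ} (ha : 0 ≤ a) (hb : 0 ≤ b) (hab : a + b = 1) :
    a * (trFn f (A + S) - trFn f A) + b * (trFn f (B + S) - trFn f B) ≤
      trFn f (a • A + b • B + S) - trFn f (a • A + b • B) := by
  have h := (hf.2 n).2 (x := ![A, S]) (y := ![B, S])
    (by intro i; fin_cases i <;> simpa) (by intro i; fin_cases i <;> simpa) ha hb hab
  have hS' : a • S + b • S = S := by rw [← add_smul, hab, one_smul]
  simp only [Fin.sum_univ_two, Pi.add_apply, Pi.smul_apply, Matrix.cons_val_zero,
    Matrix.cons_val_one, smul_eq_mul, hS'] at h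
  have hc : a * trFn f S + b * trFn f S = trFn f S := by rw [← add_mul, hab, one_mul]
  linarith

lemma trFn_increment_lower_bound
    (hg : ∀ x y, 0 < x → 0 < y → f x + g x * (y - x) ≤ f y) (hmono : MonotoneOn g (Set.Ioi 0))
    {K S : Matrix (Fin n) (Fin n) ℂ} (hK : K.PosDef) (hS : S.PosDef) {c : ℝ} (hc : 0 < c)
    (hcK : ∀ i, c ≤ hK.isHermitian.eigenvalues i) :
    g c * (Matrix.trace S).re ≤ trFn f (K + S) - trFn f K := by
  have h1 := klein_inequality (f := f) (g := g) (hK.add hS).isHermitian hK.isHermitian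
    (fun i j => hg _ _ (hK.eigenvalues_pos j) ((hK.add hS).eigenvalues_pos i))
  rw [add_sub_cancel_left] at h1
  have h2 : (matFn (fun x => g x + (-g c)) K).PosSemidef := by
    rw [posSemidef_matFn_iff _ hK.isHermitian]
    intro i
    have := hmono (Set.mem_Ioi.2 hc) (Set.mem_Ioi.2 (hK.eigenvalues_pos i)) (hcK i)
    linarith
  have h3 := trace_mul_nonneg h2 hS.posSemidef
  rw [matFn_add g (fun _ => -g c), matFn_const _ hK.isHermitian, Matrix.add_mul,
    Matrix.trace_add, Matrix.smul_mul, Matrix.one_mul, Matrix.trace_smul] at h3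
  simp only [Complex.add_re, Complex.smul_re, smul_eq_mul] at h3
  linarith

lemma SubentropicOfOrder.trFn_increment_mono (hf : SubentropicOfOrder f 2)
    (hg : ∀ x y, 0 < x → 0 < y → f x + g x * (y - x) ≤ f y) (hmono : MonotoneOn g (Set.Ioi 0))
    {A B S : Matrix (Fin n) (Fin n) ℂ} (hA : A.PosDef) (hAB : (B - A).PosSemidef)
    (hS : S.PosDef) : trFn f (A + S) - trFn f A ≤ trFn f (B + S) - trFn f B := by
  obtain ⟨c, hc, hcA⟩ := exists_pos_le_eigenvalues hA
  have key : ∀ s : ℝ, 0 < s → s < 1 → (1 - s) * (trFn f (A + S) - trFn f A) +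
      s * (g c * (Matrix.trace S).re) ≤ trFn f (B + S) - trFn f B := by
    intro s hs hs1
    have hP : (s⁻¹ • (B - A)).PosSemidef := hAB.smul (inv_nonneg.2 hs.le)
    have hK : (A + s⁻¹ • (B - A)).PosDef := hA.add_posSemidef hP
    have hcK : ∀ i, c ≤ hK.isHermitian.eigenvalues i := by
      rw [← posSemidef_sub_smul_one_iff, add_sub_right_comm]
      exact ((posSemidef_sub_smul_one_iff c hA.isHermitian).2 hcA).add hP
    have h1 := trFn_increment_lower_bound hg hmono hK hS hc hcK
    have h2 := hf.trFn_increment_concave hA hK hS (sub_nonneg.2 hs1.le) hs.le (by ring)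
    have h3 : (1 - s) • A + s • (A + s⁻¹ • (B - A)) = B := by
      rw [smul_add, smul_smul, mul_inv_cancel₀ hs.ne', one_smul, sub_smul, one_smul]
      abel
    rw [h3] at h2
    linarith [mul_le_mul_of_nonneg_left h1 hs.le]
  have hlim : Filter.Tendsto (fun s : ℝ => (1 - s) * (trFn f (A + S) - trFn f A) +
      s * (g c * (Matrix.trace S).re)) (nhdsWithin 0 (Set.Ioi 0))
      (nhds ((1 - 0) * (trFn f (A + S) - trFn f A) + 0 * (g c * (Matrix.trace S).re))) := by
    refine Filter.Tendsto.mono_left ?_ nhdsWithin_le_nhds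
    exact Continuous.tendsto (f := fun s : ℝ => (1 - s) * (trFn f (A + S) - trFn f A) +
      s * (g c * (Matrix.trace S).re)) (by fun_prop) 0
  have := le_of_tendsto hlim (Filter.eventually_of_mem (Ioo_mem_nhdsGT one_pos)
    fun s hs => key s hs.1 hs.2)
  simpa using this

/-- A subgradient of a subentropic function of order two is operator monotone with respect to
the strict order. -/
lemma SubentropicOfOrder.subgradient_operator_mono (hf : SubentropicOfOrder f 2)
    (hg : ∀ x y, 0 < x → 0 < y → f x + g x * (y - x) ≤ f y) (hmono : MonotoneOn g (Set.Ioi 0))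
    {A B : Matrix (Fin n) (Fin n) ℂ} (hA : A.PosDef) {δ : ℝ} (hδ : 0 < δ)
    (hAB : (B - A - δ • (1 : Matrix (Fin n) (Fin n) ℂ)).PosSemidef) :
    (matFn g B - matFn g A).PosSemidef := by
  refine posSemidef_of_trace_mul_nonneg
    ((isHermitian_matFn g B).sub (isHermitian_matFn g A)) fun Z hZ => ?_
  obtain ⟨z, hz, hzZ⟩ := exists_smul_one_sub_posSemidef hZ.isHermitian
  set t : ℝ := δ / z with ht
  have ht0 : 0 < t := div_pos hδ hz
  have hZt : (t • Z).PosDef := hZ.smul ht0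
  have hstep : (B - t • Z - A).PosSemidef := by
    have h1 : B - t • Z - A = (B - A - δ • (1 : Matrix (Fin n) (Fin n) ℂ)) +
        t • (z • (1 : Matrix (Fin n) (Fin n) ℂ) - Z) := by
      rw [smul_sub, smul_smul, ht, div_mul_cancel₀ _ hz.ne']
      abel
    rw [h1]
    exact hAB.add (hzZ.smul ht0.le)
  have hBt : (B - t • Z).PosDef := by
    have := hA.add_posSemidef hstep
    rwa [add_sub_cancel] at this
  have hB : B.PosDef := by
    have := hBt.add hZt
    rwa [sub_add_cancel] at this
  have h1 := klein_inequality (f := f) (g := g) (hA.add hZt).isHermitian hA.isHermitian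
    (fun i j => hg _ _ (hA.eigenvalues_pos j) ((hA.add hZt).eigenvalues_pos i))
  have h2 := klein_inequality (f := f) (g := g) hBt.isHermitian hB.isHermitian
    (fun i j => hg _ _ (hB.eigenvalues_pos j) (hBt.eigenvalues_pos i))
  have h3 := hf.trFn_increment_mono hg hmono hA hstep hZt
  rw [add_sub_cancel_left, Matrix.mul_smul, Matrix.trace_smul] at h1
  rw [sub_sub_cancel_left, Matrix.mul_neg, Matrix.trace_neg, Matrix.mul_smul,
    Matrix.trace_smul] at h2
  rw [sub_add_cancel] at h3
  simp only [Complex.neg_re, Complex.smul_re, smul_eq_mul] at h1 h2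
  rw [Matrix.sub_mul, Matrix.trace_sub, Complex.sub_re]
  have h4 : 0 ≤ t * ((Matrix.trace (matFn g B * Z)).re - (Matrix.trace (matFn g A * Z)).re) := by
    linarith
  exact nonneg_of_mul_nonneg_right h4 ht0

end Monotonicity

section DifferenceQuotient

variable {n : ℕ} {f g : ℝ → ℝ}

/-- The difference quotient `(f(ε + s y) - f(ε)) / y`, extended to `y = 0` by `s g(ε)`. -/
def scaledQuotient (f g : ℝ → ℝ) (ε s y : ℝ) : ℝ :=
  if y = 0 then s * g ε else (f (ε + s * y) - f ε) / y

lemma mul_scaledQuotient (ε s y : ℝ) :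
    y * scaledQuotient f g ε s y = f (ε + s * y) - f ε := by
  by_cases hy : y = 0
  · simp [scaledQuotient, hy]
  · rw [scaledQuotient, if_neg hy, mul_div_cancel₀ _ hy]

lemma scaledQuotient_zero (ε y : ℝ) : scaledQuotient f g ε 0 y = 0 := by
  simp [scaledQuotient]

lemma continuousOn_scaledQuotient (hf : ContinuousOn f (Set.Ioi 0)) {ε y : ℝ} (hε : 0 < ε)
    (hy : 0 ≤ y) : ContinuousOn (fun s => scaledQuotient f g ε s y) (Set.Icc 0 1) := by
  unfold scaledQuotient
  by_cases h : y = 0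
  · simp only [h, if_true]
    fun_prop
  · simp only [h, if_false]
    refine ContinuousOn.div_const (ContinuousOn.sub ?_ continuousOn_const) _
    refine hf.comp (by fun_prop) fun s hs => ?_
    have := mul_nonneg hs.1 hy
    exact Set.mem_Ioi.2 (by linarith)

lemma hasDerivWithinAt_scaledQuotient
    (hf : ∀ x, 0 < x → HasDerivWithinAt f (g x) (Set.Ici x) x) {ε s y : ℝ} (hε : 0 < ε)
    (hs : 0 ≤ s) (hy : 0 ≤ y) :
    HasDerivWithinAt (fun s => scaledQuotient f g ε s y) (g (ε + s * y)) (Set.Ici s) s := by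
  unfold scaledQuotient
  by_cases h : y = 0
  · simp only [h, if_true, mul_zero, add_zero]
    simpa using (hasDerivWithinAt_id s (Set.Ici s)).mul_const (g ε)
  · simp only [h, if_false]
    have h1 : HasDerivWithinAt (fun s : ℝ => ε + s * y) y (Set.Ici s) s := by
      simpa using ((hasDerivWithinAt_id s (Set.Ici s)).mul_const y).const_add ε
    have h2 := (hf (ε + s * y) (by positivity)).comp s h1 (fun t ht => by
      have := mul_le_mul_of_nonneg_right (Set.mem_Ici.1 ht) hy
      exact Set.mem_Ici.2 (by linarith))
    have h3 := (h2.sub_const (f ε)).div_const y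
    rwa [mul_div_cancel_right₀ _ h] at h3

lemma matFn_smul_one_add_smul (p : ℝ → ℝ) (a b : ℝ) {d : Type} [Fintype d] [DecidableEq d]
    {A : Matrix d d ℂ} (hA : A.IsHermitian) :
    matFn p (a • (1 : Matrix d d ℂ) + b • A) = matFn (fun x => p (a + b * x)) A := by
  have h := matFn_affine a b hA
  exact matFn_comp_of_eq p (fun x => a + b * x) hA (h ▸ isHermitian_matFn _ A) h.symm

lemma SubentropicOfOrder.scaledQuotient_operator_mono (hf : SubentropicOfOrder f 2)
    (hg : ∀ x y, 0 < x → 0 < y → f x + g x * (y - x) ≤ f y) (hmono : MonotoneOn g (Set.Ioi 0))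
    (hderiv : ∀ x, 0 < x → HasDerivWithinAt f (g x) (Set.Ici x) x)
    {P Q : Matrix (Fin n) (Fin n) ℂ} (hP : P.PosSemidef) (hPQ : (Q - P).PosSemidef)
    {ε ε' : ℝ} (hε : 0 < ε) (hε' : ε < ε') :
    (matFn (scaledQuotient f g ε' 1) Q - matFn (scaledQuotient f g ε 1) P).PosSemidef := by
  have hQ : Q.PosSemidef := by
    have := hPQ.add hP
    rwa [sub_add_cancel] at this
  have hcont : ContinuousOn f (Set.Ioi 0) := hf.1.continuousOn isOpen_Ioi
  refine posSemidef_of_trace_mul_nonneg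
    ((isHermitian_matFn _ Q).sub (isHermitian_matFn _ P)) fun Z hZ => ?_
  have hc : ∀ {A : Matrix (Fin n) (Fin n) ℂ} {η : ℝ}, A.PosSemidef → 0 < η →
      ContinuousOn (fun s => (Matrix.trace (matFn (scaledQuotient f g η s) A * Z)).re)
        (Set.Icc 0 1) := by
    intro A η hA hη
    simp only [trace_matFn_mul _ _ hA.isHermitian]
    exact continuousOn_finsetSum _ fun i _ =>
      (continuousOn_scaledQuotient hcont hη (hA.eigenvalues_nonneg i)).mul continuousOn_const
  have hd : ∀ {A : Matrix (Fin n) (Fin n) ℂ} {η s : ℝ}, A.PosSemidef → 0 < η → 0 ≤ s →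
      HasDerivWithinAt (fun s => (Matrix.trace (matFn (scaledQuotient f g η s) A * Z)).re)
        (Matrix.trace (matFn g (η • (1 : Matrix (Fin n) (Fin n) ℂ) + s • A) * Z)).re
        (Set.Ici s) s := by
    intro A η s hA hη hs
    simp only [matFn_smul_one_add_smul _ _ _ hA.isHermitian, trace_matFn_mul _ _ hA.isHermitian]
    exact HasDerivWithinAt.fun_sum fun i _ =>
      (hasDerivWithinAt_scaledQuotient hderiv hη hs (hA.eigenvalues_nonneg i)).mul_const _
  have hz : ∀ {A : Matrix (Fin n) (Fin n) ℂ} {η : ℝ}, A.PosSemidef →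
      (Matrix.trace (matFn (scaledQuotient f g η 0) A * Z)).re = 0 := by
    intro A η hA
    simp [trace_matFn_mul _ _ hA.isHermitian, scaledQuotient_zero]
  have hle := image_le_of_deriv_right_le_deriv_boundary (hc hP hε)
    (fun s hs => hd hP hε hs.1) (by rw [hz hP, hz hQ]) (hc hQ (hε.trans hε'))
    (fun s hs => hd hQ (hε.trans hε') hs.1) (fun s hs => by
      have hpd : (ε • (1 : Matrix (Fin n) (Fin n) ℂ) + s • P).PosDef :=
        (Matrix.PosDef.one.smul hε).add_posSemidef (hP.smul hs.1)
      have hsub : (ε' • (1 : Matrix (Fin n) (Fin n) ℂ) + s • Q -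
          (ε • (1 : Matrix (Fin n) (Fin n) ℂ) + s • P) -
          (ε' - ε) • (1 : Matrix (Fin n) (Fin n) ℂ)).PosSemidef := by
        have h1 : ε' • (1 : Matrix (Fin n) (Fin n) ℂ) + s • Q -
            (ε • (1 : Matrix (Fin n) (Fin n) ℂ) + s • P) -
            (ε' - ε) • (1 : Matrix (Fin n) (Fin n) ℂ) = s • (Q - P) := by
          rw [smul_sub, sub_smul]
          abel
        rw [h1]
        exact hPQ.smul hs.1
      have := trace_mul_nonneg
        (hf.subgradient_operator_mono hg hmono hpd (sub_pos.2 hε') hsub) hZ.posSemidef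
      rw [Matrix.sub_mul, Matrix.trace_sub, Complex.sub_re] at this
      linarith) (Set.right_mem_Icc.2 zero_le_one)
  rw [Matrix.sub_mul, Matrix.trace_sub, Complex.sub_re]
  linarith

end DifferenceQuotient

section OperatorJensen

variable {n : ℕ} {f g : ℝ → ℝ}

lemma exists_orthogonal_isometries (n : ℕ) :
    ∃ S T : Matrix (Fin (n + n)) (Fin n) ℂ, Sᴴ * S = 1 ∧ Tᴴ * T = 1 ∧ Sᴴ * T = 0 := by
  refine ⟨(1 : Matrix _ _ ℂ).submatrix id (Fin.castAdd n),
    (1 : Matrix _ _ ℂ).submatrix id (Fin.natAdd n), ?_, ?_, ?_⟩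
  all_goals
    ext i j
    simp only [Matrix.mul_apply, Matrix.conjTranspose_apply, Matrix.submatrix_apply, id,
      Matrix.one_apply, mul_ite, mul_one, mul_zero, Finset.sum_ite_eq', Finset.mem_univ, if_true]
    simp [Fin.ext_iff, eq_comm]
  intro h
  have := i.isLt
  omega

/-- Hansen and Pedersen's argument: monotonicity of the difference quotients yields convexity. -/
lemma SubentropicOfOrder.operator_convex_shift (hf : SubentropicOfOrder f 2)
    (hg : ∀ x y, 0 < x → 0 < y → f x + g x * (y - x) ≤ f y) (hmono : MonotoneOn g (Set.Ioi 0))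
    (hderiv : ∀ x, 0 < x → HasDerivWithinAt f (g x) (Set.Ici x) x)
    {P Q : Matrix (Fin n) (Fin n) ℂ} (hP : P.PosSemidef) (hQ : Q.PosSemidef)
    {ε ε' : ℝ} (hε : 0 < ε) (hε' : ε < ε') {l : ℝ} (hl : 0 ≤ l) (hl1 : l ≤ 1) :
    (l • matFn (fun y => f (ε' + y) - f ε') P + (1 - l) • matFn (fun y => f (ε' + y) - f ε') Q -
      matFn (fun y => f (ε + y) - f ε) (l • P + (1 - l) • Q)).PosSemidef := by
  obtain ⟨S, T, hS, hT, hST⟩ := exists_orthogonal_isometries n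
  have hTS : Tᴴ * S = 0 := by
    have := congrArg Matrix.conjTranspose hST
    simpa using this
  set X : Matrix (Fin (n + n)) (Fin (n + n)) ℂ := S * P * Sᴴ + T * Q * Tᴴ with hXdef
  have hX : X.PosSemidef := (hP.mul_mul_conjTranspose_same S).add (hQ.mul_mul_conjTranspose_same T)
  have hXS : X * S = S * P := by
    rw [hXdef, Matrix.add_mul, Matrix.mul_assoc _ Sᴴ, Matrix.mul_assoc _ Tᴴ, hS, hTS]
    simp
  have hXT : X * T = T * Q := by
    rw [hXdef, Matrix.add_mul, Matrix.mul_assoc _ Sᴴ, Matrix.mul_assoc _ Tᴴ, hT, hST]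
    simp
  set a : ℝ := Real.sqrt l
  set b : ℝ := Real.sqrt (1 - l)
  have haa : a * a = l := Real.mul_self_sqrt hl
  have hbb : b * b = 1 - l := Real.mul_self_sqrt (sub_nonneg.2 hl1)
  set V : Matrix (Fin (n + n)) (Fin n) ℂ := a • S + b • T with hV
  have hVstar : Vᴴ = a • Sᴴ + b • Tᴴ := by
    rw [hV, Matrix.conjTranspose_add, Matrix.conjTranspose_smul, Matrix.conjTranspose_smul]
    simp
  have hcompress : ∀ p : ℝ → ℝ, Vᴴ * matFn p X * V = l • matFn p P + (1 - l) • matFn p Q := by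
    intro p
    have h1 := matFn_mul_eq_mul_matFn p hX.isHermitian hP.isHermitian hXS
    have h2 := matFn_mul_eq_mul_matFn p hX.isHermitian hQ.isHermitian hXT
    rw [Matrix.mul_assoc, hVstar, hV, Matrix.mul_add, Matrix.mul_smul, Matrix.mul_smul, h1, h2]
    simp only [Matrix.add_mul, Matrix.mul_add, Matrix.smul_mul, Matrix.mul_smul,
      ← Matrix.mul_assoc, hS, hT, hST, hTS, Matrix.one_mul, smul_zero,
      add_zero, zero_add, smul_smul, haa, hbb]
  have hVV : Vᴴ * V = 1 := by
    have := hcompress (fun _ => 1)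
    rw [matFn_const _ hX.isHermitian, matFn_const _ hP.isHermitian,
      matFn_const _ hQ.isHermitian] at this
    simpa [← add_smul] using this
  set C : Matrix (Fin n) (Fin n) ℂ := l • P + (1 - l) • Q with hC
  have hCpsd : C.PosSemidef := (hP.smul hl).add (hQ.smul (sub_nonneg.2 hl1))
  have hCX : Vᴴ * X * V = C := by
    have := hcompress (fun x => x)
    rwa [matFn_id hX.isHermitian, matFn_id hP.isHermitian, matFn_id hQ.isHermitian] at this
  set R : Matrix (Fin (n + n)) (Fin (n + n)) ℂ := matFn Real.sqrt X with hR
  have hRstar : Rᴴ = R := isHermitian_matFn _ X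
  have hRpR : ∀ p : ℝ → ℝ, R * matFn p X * R = matFn (fun x => x * p x) X := by
    intro p
    rw [hR, ← matFn_mul, ← matFn_mul]
    refine matFn_congr hX.isHermitian fun i => ?_
    rw [mul_right_comm, Real.mul_self_sqrt (hX.eigenvalues_nonneg i)]
  have hRR : R * R = X := by
    have := hRpR (fun _ => 1)
    simp only [mul_one] at this
    rwa [matFn_const _ hX.isHermitian, one_smul, Matrix.mul_one, matFn_id hX.isHermitian] at this
  set Y : Matrix (Fin (n + n)) (Fin (n + n)) ℂ := R * (V * Vᴴ) * R with hY
  have hYpsd : Y.PosSemidef := by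
    have := (Matrix.posSemidef_self_mul_conjTranspose V).mul_mul_conjTranspose_same R
    rwa [hRstar] at this
  have hXY : (X - Y).PosSemidef := by
    have h1 : (1 - V * Vᴴ) = (1 - V * Vᴴ)ᴴ * (1 - V * Vᴴ) := by
      have h2 : V * Vᴴ * (V * Vᴴ) = V * Vᴴ := by
        rw [Matrix.mul_assoc, ← Matrix.mul_assoc Vᴴ, hVV, Matrix.one_mul]
      rw [Matrix.conjTranspose_sub, Matrix.conjTranspose_one, Matrix.conjTranspose_mul,
        Matrix.conjTranspose_conjTranspose, Matrix.sub_mul, Matrix.mul_sub, Matrix.mul_sub, h2]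
      simp
    have h3 : (1 - V * Vᴴ).PosSemidef := by
      rw [h1]
      exact Matrix.posSemidef_conjTranspose_mul_self _
    have h4 := h3.mul_mul_conjTranspose_same R
    rwa [hRstar, Matrix.mul_sub, Matrix.mul_one, Matrix.sub_mul, hRR] at h4
  have hmain := (hf.scaledQuotient_operator_mono hg hmono hderiv hYpsd hXY hε
    hε').mul_mul_conjTranspose_same (Vᴴ * R)
  have hfold : ∀ η : ℝ, (fun y => f (η + y) - f η) = fun y => y * scaledQuotient f g η 1 y := by
    intro η
    funext y
    rw [mul_scaledQuotient, one_mul]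
  have hupper : Vᴴ * R * matFn (scaledQuotient f g ε' 1) X * (R * V) =
      l • matFn (fun y => f (ε' + y) - f ε') P +
        (1 - l) • matFn (fun y => f (ε' + y) - f ε') Q := by
    rw [← hcompress, hfold, ← hRpR]
    simp only [Matrix.mul_assoc]
  have hlower : Vᴴ * R * matFn (scaledQuotient f g ε 1) Y * (R * V) =
      matFn (fun y => f (ε + y) - f ε) C := by
    have hYC : Y * (R * V) = R * V * C := by
      rw [hY, ← hCX, ← hRR]
      simp only [Matrix.mul_assoc]
    rw [Matrix.mul_assoc, matFn_mul_eq_mul_matFn _ hYpsd.isHermitian hCpsd.isHermitian hYC,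
      hfold, matFn_mul (fun y => y), matFn_id hCpsd.isHermitian, ← hCX, ← hRR]
    simp only [Matrix.mul_assoc]
  rw [Matrix.conjTranspose_mul, Matrix.conjTranspose_conjTranspose, hRstar, Matrix.mul_sub,
    Matrix.sub_mul, hupper, hlower] at hmain
  exact hmain

end OperatorJensen

lemma ConvexOn.rightDeriv_subgradient {f : ℝ → ℝ} (hf : ConvexOn ℝ (Set.Ioi 0) f) {x y : ℝ}
    (hx : 0 < x) (hy : 0 < y) : f x + derivWithin f (Set.Ioi x) x * (y - x) ≤ f y := by
  have hxi : x ∈ interior (Set.Ioi (0 : ℝ)) := by rwa [interior_Ioi]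
  rcases lt_trichotomy x y with h | rfl | h
  · have := hf.rightDeriv_le_slope_of_mem_interior hxi hy h
    rw [slope_def_field, le_div_iff₀ (sub_pos.2 h)] at this
    linarith
  · simp
  · have h1 := hf.slope_le_leftDeriv_of_mem_interior hy hxi h
    have h2 := h1.trans (hf.leftDeriv_le_rightDeriv_of_mem_interior hxi)
    rw [slope_def_field, div_le_iff₀ (sub_pos.2 h)] at h2
    linarith

/-- A function subentropic of order two is operator convex. -/
theorem subentropic_order_two_operator_convex (f : ℝ → ℝ)
    (hf : SubentropicOfOrder f 2) :
    ∀ n : ℕ, ∀ ρ σ : Matrix (Fin n) (Fin n) ℂ, ρ.PosDef → σ.PosDef →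
      ∀ l : ℝ, 0 ≤ l → l ≤ 1 →
        (l • matFn f ρ + (1 - l) • matFn f σ
          - matFn f (l • ρ + (1 - l) • σ)).PosSemidef := by
  intro n ρ σ hρ hσ l hl hl1
  obtain ⟨c₁, hc₁, h₁⟩ := exists_pos_le_eigenvalues hρ
  obtain ⟨c₂, hc₂, h₂⟩ := exists_pos_le_eigenvalues hσ
  obtain ⟨c, hc, hcc₁, hcc₂⟩ : ∃ c : ℝ, 0 < c ∧ c ≤ c₁ ∧ c ≤ c₂ :=
    ⟨min c₁ c₂, lt_min hc₁ hc₂, min_le_left _ _, min_le_right _ _⟩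
  have hP : (ρ - c • (1 : Matrix (Fin n) (Fin n) ℂ)).PosSemidef :=
    (posSemidef_sub_smul_one_iff c hρ.isHermitian).2 fun i => hcc₁.trans (h₁ i)
  have hQ : (σ - c • (1 : Matrix (Fin n) (Fin n) ℂ)).PosSemidef :=
    (posSemidef_sub_smul_one_iff c hσ.isHermitian).2 fun i => hcc₂.trans (h₂ i)
  set P := ρ - c • (1 : Matrix (Fin n) (Fin n) ℂ) with hPdef
  set Q := σ - c • (1 : Matrix (Fin n) (Fin n) ℂ) with hQdef
  have hC : (l • P + (1 - l) • Q).PosSemidef := (hP.smul hl).add (hQ.smul (sub_nonneg.2 hl1))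
  have hshift : ∀ {A B : Matrix (Fin n) (Fin n) ℂ}, A.PosSemidef →
      B = c • (1 : Matrix (Fin n) (Fin n) ℂ) + A → matFn f B = matFn (fun y => f (c + y)) A := by
    intro A B hA hB
    have := matFn_smul_one_add_smul f c 1 hA.isHermitian
    simpa only [one_smul, one_mul, ← hB] using this
  have hCeq : l • ρ + (1 - l) • σ =
      c • (1 : Matrix (Fin n) (Fin n) ℂ) + (l • P + (1 - l) • Q) := by
    rw [hPdef, hQdef]
    module
  refine posSemidef_of_trace_mul_nonneg ((Matrix.IsHermitian.add ?_ ?_).sub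
    (isHermitian_matFn _ _)) fun Z hZ => ?_
  · exact (isHermitian_matFn f ρ).smul (IsSelfAdjoint.all l)
  · exact (isHermitian_matFn f σ).smul (IsSelfAdjoint.all (1 - l))
  have hcont : ContinuousOn f (Set.Ioi 0) := hf.1.continuousOn isOpen_Ioi
  have hlim : ∀ {A : Matrix (Fin n) (Fin n) ℂ}, A.PosSemidef →
      Filter.Tendsto (fun ε => (Matrix.trace (matFn (fun y => f (ε + y) - f ε) A * Z)).re)
        (nhdsWithin c (Set.Ioi c))
        (nhds (Matrix.trace (matFn (fun y => f (c + y) - f c) A * Z)).re) := by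
    intro A hA
    simp only [trace_matFn_mul _ _ hA.isHermitian]
    refine tendsto_finsetSum _ fun i _ => Filter.Tendsto.mul_const _ (Filter.Tendsto.sub ?_ ?_)
    · have hpos : 0 < c + hA.isHermitian.eigenvalues i :=
        add_pos_of_pos_of_nonneg hc (hA.eigenvalues_nonneg i)
      refine ((hcont.continuousAt (Ioi_mem_nhds hpos)).tendsto.comp ?_).mono_left
        nhdsWithin_le_nhds
      exact Continuous.tendsto (f := fun ε : ℝ => ε + hA.isHermitian.eigenvalues i)
        (by fun_prop) c
    · exact (hcont.continuousAt (Ioi_mem_nhds hc)).tendsto.mono_left nhdsWithin_le_nhds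
  have hineq : (Matrix.trace (matFn (fun y => f (c + y) - f c) (l • P + (1 - l) • Q) * Z)).re ≤
      l * (Matrix.trace (matFn (fun y => f (c + y) - f c) P * Z)).re +
        (1 - l) * (Matrix.trace (matFn (fun y => f (c + y) - f c) Q * Z)).re := by
    refine ge_of_tendsto (((hlim hP).const_mul l).add ((hlim hQ).const_mul (1 - l)))
      (eventually_mem_nhdsWithin.mono fun ε hε => ?_)
    have hmono := hf.1.monotoneOn_rightDeriv
    rw [interior_Ioi] at hmono
    have h := trace_mul_nonneg (hf.operator_convex_shift
      (g := fun x => derivWithin f (Set.Ioi x) x)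
      (fun x y hx hy => hf.1.rightDeriv_subgradient hx hy) hmono
      (fun x hx => (hf.1.hasDerivWithinAt_rightDeriv_of_mem_interior
        (by rwa [interior_Ioi])).Ici_of_Ioi) hP hQ hc hε hl hl1) hZ.posSemidef
    simp only [Matrix.sub_mul, Matrix.add_mul, Matrix.smul_mul, Matrix.trace_sub,
      Matrix.trace_add, Matrix.trace_smul, Complex.sub_re, Complex.add_re, Complex.smul_re,
      smul_eq_mul] at h
    linarith
  have hsplit : ∀ {A : Matrix (Fin n) (Fin n) ℂ}, A.PosSemidef →
      (Matrix.trace (matFn (fun y => f (c + y) - f c) A * Z)).re =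
        (Matrix.trace (matFn (fun y => f (c + y)) A * Z)).re - f c * (Matrix.trace Z).re := by
    intro A hA
    simp only [sub_eq_add_neg]
    rw [matFn_add (fun y => f (c + y)) (fun _ => -f c), matFn_const _ hA.isHermitian,
      Matrix.add_mul, Matrix.smul_mul, Matrix.one_mul, Matrix.trace_add, Matrix.trace_smul]
    simp
  rw [hsplit hP, hsplit hQ, hsplit hC] at hineq
  rw [hshift hP (by rw [hPdef]; abel), hshift hQ (by rw [hQdef]; abel), hshift hC hCeq]
  simp only [Matrix.sub_mul, Matrix.add_mul, Matrix.smul_mul, Matrix.trace_sub,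
    Matrix.trace_add, Matrix.trace_smul, Complex.sub_re, Complex.add_re, Complex.smul_re,
    smul_eq_mul]
  linarith

end
end
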